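/- arXiv:2308.05078 — 7 statements merged into one kernel-verified Lean document; each statement's English description precedes it below -/
import Mathlib

section
/- Let m_T, m_R ≥ 1/2 and Ω_T, Ω_R > 0, and set b = Ω_T Ω_R/(m_T m_R). Let f be the density of the product of two independent Gamma random variables with shapes m_T, m_R and scales Ω_T/m_T, Ω_R/m_R respectively, i.e. f(λ) = ∫_0^∞ g_{m_T,Ω_T/m_T}(z) · g_{m_R,Ω_R/m_R}(λ/z) · z^{-1} dz for λ > 0. Suppose x : (0,∞) → (0,∞) satisfies the power-constraint equation ∫_{x(s)}^∞ (1/x(s) − 1/λ) f(λ) dλ = s for every s > 0, and define the capacity C(s) = ∫_{x(s)}^∞ log(λ/x(s)) f(λ) dλ. Then C(s) / ( b · (s/4) · log²(1/s) ) → 1 as s → 0+. -/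
open MeasureTheory Filter Set Topology

/-- Gamma density with shape `m` and scale `θ`. -/
noncomputable def gammaDen (m θ z : ℝ) : ℝ :=
  if 0 < z then z ^ (m - 1) * Real.exp (-z / θ) / (Real.Gamma m * θ ^ m) else 0

/-- The integral `∫₀^∞ t ^ p * exp (-r (t + 1 / t)) dt`, i.e. twice the modified Bessel function
`K_{p+1}` at `2 r`. -/
noncomputable def besselInt (p r : ℝ) : ℝ :=
  ∫ t in Ioi (0 : ℝ), t ^ p * Real.exp (-(r * (t + 1 / t)))

lemma integrableOn_besselInt (p : ℝ) {r : ℝ} (hr : 0 < r) :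
    IntegrableOn (fun t : ℝ => t ^ p * Real.exp (-(r * (t + 1 / t)))) (Ioi 0) := by
  obtain ⟨n, hn⟩ := exists_nat_gt (-1 - p)
  have h := (integrableOn_rpow_mul_exp_neg_mul_rpow (s := p + n) (by linarith)
    one_pos hr).const_mul (n.factorial / r ^ n)
  refine Integrable.mono' h (by fun_prop) ?_
  filter_upwards [ae_restrict_mem measurableSet_Ioi] with t ht
  have ht : 0 < t := ht
  rw [Real.norm_of_nonneg (by positivity)]
  have h1 := Real.pow_div_factorial_le_exp (r / t) (by positivity) n
  have h2 : Real.exp (-(r / t)) ≤ n.factorial / r ^ n * t ^ n := by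
    rw [Real.exp_neg]
    refine (inv_anti₀ (by positivity) h1).trans (le_of_eq ?_)
    rw [div_pow]
    field_simp
  have h3 : Real.exp (-(r * (t + 1 / t))) = Real.exp (-r * t) * Real.exp (-(r / t)) := by
    rw [← Real.exp_add]; congr 1; ring
  rw [h3, Real.rpow_add ht, Real.rpow_natCast, Real.rpow_one]
  calc t ^ p * (Real.exp (-r * t) * Real.exp (-(r / t)))
      ≤ t ^ p * (Real.exp (-r * t) * (n.factorial / r ^ n * t ^ n)) := by gcongr
    _ = _ := by ring

lemma besselInt_nonneg (p r : ℝ) : 0 ≤ besselInt p r :=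
  setIntegral_nonneg measurableSet_Ioi fun t (ht : 0 < t) => by positivity

lemma besselInt_le (p : ℝ) {ε r : ℝ} (hε : 0 < ε) (hε1 : ε ≤ 1) (hr : 1 ≤ r) :
    besselInt p r ≤ besselInt p ε * Real.exp (-(2 * (1 - ε) * r)) := by
  rw [besselInt, besselInt, ← integral_mul_const]
  refine setIntegral_mono_on (integrableOn_besselInt p (by linarith))
    ((integrableOn_besselInt p hε).mul_const _) measurableSet_Ioi fun t (ht : 0 < t) => ?_
  rw [mul_assoc, ← Real.exp_add]
  have h2 : 2 ≤ t + 1 / t := by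
    have : t + 1 / t - 2 = (t - 1) ^ 2 / t := by field_simp; ring
    have : 0 ≤ (t - 1) ^ 2 / t := by positivity
    linarith
  gcongr
  have h3 : 0 ≤ (1 - ε) * r * (t + 1 / t - 2) :=
    mul_nonneg (mul_nonneg (by linarith) (by linarith)) (by linarith)
  have h4 : 0 ≤ ε * (r - 1) * (t + 1 / t) :=
    mul_nonneg (mul_nonneg (by linarith) (by linarith)) (by linarith)
  linarith

lemma le_besselInt (p : ℝ) {ε : ℝ} (hε : 0 < ε) :
    ∃ k > 0, ∀ r > 0, k * Real.exp (-((2 + ε) * r)) ≤ besselInt p r := by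
  have hpos : ∀ t ∈ Icc 1 (1 + ε), 0 < t := fun t ht => by linarith [ht.1]
  obtain ⟨t₀, ht₀, hmin⟩ := isCompact_Icc.exists_isMinOn (f := fun t : ℝ => t ^ p)
    (nonempty_Icc.2 (by linarith : (1 : ℝ) ≤ 1 + ε))
    (fun t ht => (Real.continuousAt_rpow_const _ _ (Or.inl (hpos t ht).ne')).continuousWithinAt)
  have hk : 0 < t₀ ^ p := Real.rpow_pos_of_pos (hpos t₀ ht₀) _
  refine ⟨ε * t₀ ^ p, by positivity, fun r hr => ?_⟩
  have hsub : Icc 1 (1 + ε) ⊆ Ioi (0 : ℝ) := hpos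
  have hint := integrableOn_besselInt p hr
  have h1 := setIntegral_ge_of_const_le (c := t₀ ^ p * Real.exp (-((2 + ε) * r)))
    measurableSet_Icc (by simp) (fun t ht => ?_) (hint.mono_set hsub)
  · have h2 := setIntegral_mono_set hint (by
      filter_upwards [ae_restrict_mem measurableSet_Ioi] with t ht
      have ht : 0 < t := ht
      show 0 ≤ t ^ p * Real.exp (-(r * (t + 1 / t)))
      positivity) hsub.eventuallyLE
    refine le_trans (le_of_eq ?_) (h1.trans h2)
    rw [Real.volume_real_Icc_of_le (by linarith), smul_eq_mul]
    ring
  · have ht0 := hpos t ht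
    have h3 : 1 / t ≤ 1 := by rw [div_le_one ht0]; exact ht.1
    have h4 : t + 1 / t ≤ 2 + ε := by linarith [ht.2]
    have h5 : t₀ ^ p ≤ t ^ p := hmin ht
    have : r * (t + 1 / t) ≤ (2 + ε) * r := by
      rw [mul_comm]; gcongr
    gcongr

lemma exists_rpow_le_exp (q : ℝ) {ε : ℝ} (hε : 0 < ε) :
    ∃ A > 0, ∀ r ≥ 1, r ^ q ≤ A * Real.exp (ε * r) := by
  obtain ⟨n, hn⟩ := exists_nat_ge q
  refine ⟨n.factorial / ε ^ n, by positivity, fun r hr => ?_⟩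
  have hr0 : 0 < r := by linarith
  have h1 := Real.pow_div_factorial_le_exp (ε * r) (by positivity) n
  calc r ^ q ≤ r ^ (n : ℝ) := Real.rpow_le_rpow_of_exponent_le hr hn
    _ = n.factorial / ε ^ n * ((ε * r) ^ n / n.factorial) := by
        rw [Real.rpow_natCast, mul_pow]; field_simp
    _ ≤ _ := by gcongr

lemma measurable_gammaDen (m θ : ℝ) : Measurable (gammaDen m θ) := by
  unfold gammaDen
  exact Measurable.ite measurableSet_Ioi (by fun_prop) measurable_const

/-- The density of the product of independent Gamma variables, where `θ₁, θ₂` are the scales. -/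
noncomputable def gammaProdDen (m₁ m₂ θ₁ θ₂ lam : ℝ) : ℝ :=
  ∫ z in Ioi (0 : ℝ), gammaDen m₁ θ₁ z * gammaDen m₂ θ₂ (lam / z) * z⁻¹

lemma measurable_gammaProdDen (m₁ m₂ θ₁ θ₂ : ℝ) : Measurable (gammaProdDen m₁ m₂ θ₁ θ₂) := by
  refine (StronglyMeasurable.integral_prod_right
    (f := fun lam z : ℝ => gammaDen m₁ θ₁ z * gammaDen m₂ θ₂ (lam / z) * z⁻¹) ?_).measurable
  apply Measurable.stronglyMeasurable
  have h1 := measurable_gammaDen m₁ θ₁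
  have h2 := measurable_gammaDen m₂ θ₂
  unfold Function.uncurry
  fun_prop

lemma gammaProdDen_eq_besselInt {m₁ m₂ θ₁ θ₂ r : ℝ} (hm₁ : 0 < m₁) (hm₂ : 0 < m₂) (hθ₁ : 0 < θ₁)
    (hθ₂ : 0 < θ₂) (hr : 0 < r) :
    gammaProdDen m₁ m₂ θ₁ θ₂ (θ₁ * θ₂ * r ^ 2) =
      (θ₁ * θ₂ * Real.Gamma m₁ * Real.Gamma m₂)⁻¹ * r ^ (m₁ + m₂ - 2) *
        besselInt (m₁ - m₂ - 1) r := by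
  have hc := integral_comp_mul_left_Ioi (fun z : ℝ =>
    gammaDen m₁ θ₁ z * gammaDen m₂ θ₂ (θ₁ * θ₂ * r ^ 2 / z) * z⁻¹) 0 (mul_pos hθ₁ hr)
  rw [mul_zero, smul_eq_mul, inv_mul_eq_div, eq_div_iff (by positivity)] at hc
  rw [gammaProdDen, ← hc, besselInt, ← integral_const_mul, ← integral_mul_const]
  refine setIntegral_congr_fun measurableSet_Ioi fun t (ht : 0 < t) => ?_
  have hG₁ := Real.Gamma_pos_of_pos hm₁
  have hG₂ := Real.Gamma_pos_of_pos hm₂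
  have e1 : θ₁ * θ₂ * r ^ 2 / (θ₁ * r * t) = θ₂ * (r * t⁻¹) := by field_simp
  simp only [e1]
  rw [gammaDen, gammaDen, if_pos (by positivity), if_pos (by positivity)]
  have e2 : Real.exp (-(r * (t + 1 / t))) =
      Real.exp (-(θ₁ * r * t) / θ₁) * Real.exp (-(θ₂ * (r * t⁻¹)) / θ₂) := by
    rw [← Real.exp_add]; congr 1; field_simp; ring
  rw [e2, show m₁ + m₂ - 2 = (m₁ - 1) + (m₂ - 1) by ring, Real.rpow_add hr,
    show m₁ - m₂ - 1 = (m₁ - 1) + (-(m₂ - 1)) + (-1) by ring, Real.rpow_add ht, Real.rpow_add ht,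
    Real.mul_rpow (by positivity) ht.le, Real.mul_rpow hθ₁.le hr.le,
    Real.mul_rpow hθ₂.le (by positivity), Real.mul_rpow hr.le (by positivity),
    Real.inv_rpow ht.le, ← Real.rpow_neg ht.le, Real.rpow_neg_one,
    Real.rpow_sub_one hθ₁.ne', Real.rpow_sub_one hθ₂.ne']
  field_simp

lemma gammaProdDen_nonneg {m₁ m₂ θ₁ θ₂ lam : ℝ} (hm₁ : 0 < m₁) (hm₂ : 0 < m₂) (hθ₁ : 0 < θ₁)
    (hθ₂ : 0 < θ₂) : 0 ≤ gammaProdDen m₁ m₂ θ₁ θ₂ lam := by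
  have hnn : ∀ {m θ : ℝ}, 0 < m → 0 < θ → ∀ z, 0 ≤ gammaDen m θ z := by
    intro m θ hm hθ z
    have hG := Real.Gamma_pos_of_pos hm
    unfold gammaDen
    split_ifs <;> positivity
  exact setIntegral_nonneg measurableSet_Ioi fun z (hz : 0 < z) =>
    mul_nonneg (mul_nonneg (hnn hm₁ hθ₁ _) (hnn hm₂ hθ₂ _)) (inv_pos.2 hz).le

lemma mul_sqrt_div_sq {b lam : ℝ} (hb : 0 < b) (hl : 0 ≤ lam) : b * √(lam / b) ^ 2 = lam := by
  rw [Real.sq_sqrt (by positivity)]; field_simp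

lemma one_le_sqrt_div {b lam : ℝ} (hb : 0 < b) (hl : b ≤ lam) : 1 ≤ √(lam / b) := by
  rw [Real.one_le_sqrt, one_le_div hb]; exact hl

lemma gammaProdDen_lower {m₁ m₂ θ₁ θ₂ ε : ℝ} (hm₁ : 0 < m₁) (hm₂ : 0 < m₂) (hθ₁ : 0 < θ₁)
    (hθ₂ : 0 < θ₂) (hε : 0 < ε) :
    ∃ k > 0, ∀ lam ≥ θ₁ * θ₂, k * Real.exp (-((2 + ε) * √(lam / (θ₁ * θ₂)))) ≤
      gammaProdDen m₁ m₂ θ₁ θ₂ lam := by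
  obtain ⟨k, hk, hJ⟩ := le_besselInt (m₁ - m₂ - 1) (half_pos hε)
  obtain ⟨A, hA, hAr⟩ := exists_rpow_le_exp (-(m₁ + m₂ - 2)) (half_pos hε)
  have hG₁ := Real.Gamma_pos_of_pos hm₁
  have hG₂ := Real.Gamma_pos_of_pos hm₂
  refine ⟨(θ₁ * θ₂ * Real.Gamma m₁ * Real.Gamma m₂)⁻¹ * A⁻¹ * k, by positivity,
    fun lam hl => ?_⟩
  have hb : 0 < θ₁ * θ₂ := by positivity
  have hr := one_le_sqrt_div hb hl
  conv_rhs => rw [← mul_sqrt_div_sq hb (hb.le.trans hl)]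
  set r := √(lam / (θ₁ * θ₂))
  have hr0 : 0 < r := by linarith
  rw [gammaProdDen_eq_besselInt hm₁ hm₂ hθ₁ hθ₂ hr0]
  have h1 : A⁻¹ * Real.exp (-(ε / 2 * r)) ≤ r ^ (m₁ + m₂ - 2) := by
    have := inv_anti₀ (by positivity) (hAr r hr)
    rwa [Real.rpow_neg hr0.le, inv_inv, mul_inv, ← Real.exp_neg] at this
  calc _ = (θ₁ * θ₂ * Real.Gamma m₁ * Real.Gamma m₂)⁻¹ * (A⁻¹ * Real.exp (-(ε / 2 * r))) *
        (k * Real.exp (-((2 + ε / 2) * r))) := by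
        rw [show -((2 + ε) * r) = -(ε / 2 * r) + -((2 + ε / 2) * r) by ring, Real.exp_add]; ring
    _ ≤ _ := by
        gcongr
        exact hJ r hr0

lemma gammaProdDen_upper {m₁ m₂ θ₁ θ₂ ε : ℝ} (hm₁ : 0 < m₁) (hm₂ : 0 < m₂) (hθ₁ : 0 < θ₁)
    (hθ₂ : 0 < θ₂) (hε : 0 < ε) (hε1 : ε ≤ 1) :
    ∃ K > 0, ∀ lam ≥ θ₁ * θ₂, lam ^ 3 * gammaProdDen m₁ m₂ θ₁ θ₂ lam ≤
      K * Real.exp (-((2 - ε) * √(lam / (θ₁ * θ₂)))) := by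
  obtain ⟨A, hA, hAr⟩ := exists_rpow_le_exp (6 + (m₁ + m₂ - 2)) (half_pos hε)
  have hG₁ := Real.Gamma_pos_of_pos hm₁
  have hG₂ := Real.Gamma_pos_of_pos hm₂
  have hJ0 := besselInt_nonneg (m₁ - m₂ - 1) (ε / 4)
  refine ⟨(θ₁ * θ₂) ^ 3 * (θ₁ * θ₂ * Real.Gamma m₁ * Real.Gamma m₂)⁻¹ * A *
    (besselInt (m₁ - m₂ - 1) (ε / 4) + 1), by positivity, fun lam hl => ?_⟩
  have hb : 0 < θ₁ * θ₂ := by positivity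
  have hr := one_le_sqrt_div hb hl
  conv_lhs => rw [← mul_sqrt_div_sq hb (hb.le.trans hl)]
  set r := √(lam / (θ₁ * θ₂))
  have hr0 : 0 < r := by linarith
  rw [gammaProdDen_eq_besselInt hm₁ hm₂ hθ₁ hθ₂ hr0]
  have hr6 : r ^ (6 + (m₁ + m₂ - 2)) = r ^ 6 * r ^ (m₁ + m₂ - 2) := by
    rw [Real.rpow_add hr0]; norm_cast
  have hJ := besselInt_le (m₁ - m₂ - 1) (by linarith : 0 < ε / 4) (by linarith) hr
  calc _ = (θ₁ * θ₂) ^ 3 * (θ₁ * θ₂ * Real.Gamma m₁ * Real.Gamma m₂)⁻¹ *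
        r ^ (6 + (m₁ + m₂ - 2)) * besselInt (m₁ - m₂ - 1) r := by rw [hr6]; ring
    _ ≤ (θ₁ * θ₂) ^ 3 * (θ₁ * θ₂ * Real.Gamma m₁ * Real.Gamma m₂)⁻¹ *
        (A * Real.exp (ε / 2 * r)) *
        ((besselInt (m₁ - m₂ - 1) (ε / 4) + 1) * Real.exp (-(2 * (1 - ε / 4) * r))) := by
        gcongr
        · exact besselInt_nonneg _ _
        · exact hAr r hr
        · refine hJ.trans ?_
          gcongr
          linarith
    _ = _ := by
        rw [show -((2 - ε) * r) = ε / 2 * r + -(2 * (1 - ε / 4) * r) by ring, Real.exp_add]; ring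

/-- `f` is nonnegative and behaves like `exp (-2 √(lam / b))` at infinity, up to factors
`exp (ε √(lam / b))`. -/
structure HasExpSqrtTail (b : ℝ) (f : ℝ → ℝ) : Prop where
  pos : 0 < b
  meas : Measurable f
  nonneg : ∀ lam, 0 ≤ f lam
  lower : ∀ ε > 0, ∃ k > 0, ∀ lam ≥ b, k * Real.exp (-((2 + ε) * √(lam / b))) ≤ f lam
  upper : ∀ ε > 0, ε ≤ 1 → ∃ K > 0, ∀ lam ≥ b,
    lam ^ 3 * f lam ≤ K * Real.exp (-((2 - ε) * √(lam / b)))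

/-- The power used by water-filling with threshold `x`, for the channel gain density `f`. -/
noncomputable def waterPower (f : ℝ → ℝ) (x : ℝ) : ℝ :=
  ∫ lam in Ioi x, (1 / x - 1 / lam) * f lam

/-- The rate achieved by water-filling with threshold `x`, for the channel gain density `f`. -/
noncomputable def waterRate (f : ℝ → ℝ) (x : ℝ) : ℝ :=
  ∫ lam in Ioi x, Real.log (lam / x) * f lam

lemma inv_sub_inv_nonneg {x lam : ℝ} (hx : 0 < x) (hl : x ≤ lam) : 0 ≤ 1 / x - 1 / lam :=
  sub_nonneg.2 (one_div_le_one_div_of_le hx hl)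

namespace HasExpSqrtTail

variable {b : ℝ} {f : ℝ → ℝ}

lemma tail (h : HasExpSqrtTail b f) {ε : ℝ} (hε : 0 < ε) (hε1 : ε ≤ 1) :
    ∃ A > 0, ∀ y, b ≤ y → 1 ≤ y → IntegrableOn (fun lam => lam * f lam) (Ioi y) ∧
      ∫ lam in Ioi y, lam * f lam ≤ A * Real.exp (-((2 - ε) * √(y / b))) := by
  obtain ⟨K, hK, hup⟩ := h.upper ε hε hε1
  refine ⟨K, hK, fun y hyb hy1 => ?_⟩
  have hb := h.pos
  have hm := h.meas
  have hpt : ∀ lam ∈ Ioi y,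
      lam * f lam ≤ K * Real.exp (-((2 - ε) * √(y / b))) * lam ^ (-2 : ℝ) := by
    intro lam (hl : y < lam)
    have hl0 : 0 < lam := by linarith
    have h1 := hup lam (by linarith)
    have h2 : Real.exp (-((2 - ε) * √(lam / b))) ≤ Real.exp (-((2 - ε) * √(y / b))) := by
      have : 0 ≤ 2 - ε := by linarith
      gcongr
    have h3 : lam ^ (-2 : ℝ) = (lam ^ 2)⁻¹ := by
      rw [Real.rpow_neg hl0.le]; norm_cast
    rw [h3, ← div_eq_mul_inv, le_div_iff₀ (by positivity)]
    calc lam * f lam * lam ^ 2 = lam ^ 3 * f lam := by ring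
      _ ≤ _ := h1
      _ ≤ _ := by gcongr
  have hy0 : 0 < y := by linarith
  have hint := (integrableOn_Ioi_rpow_of_lt (by norm_num : (-2 : ℝ) < -1) hy0).const_mul
    (K * Real.exp (-((2 - ε) * √(y / b))))
  have hI : IntegrableOn (fun lam => lam * f lam) (Ioi y) := by
    refine Integrable.mono' hint (by fun_prop) ?_
    filter_upwards [ae_restrict_mem measurableSet_Ioi] with lam hl
    rw [Real.norm_of_nonneg (mul_nonneg (hy0.trans hl).le (h.nonneg _))]
    exact hpt lam hl
  refine ⟨hI, (setIntegral_mono_on hI hint measurableSet_Ioi hpt).trans ?_⟩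
  rw [integral_const_mul, integral_Ioi_rpow_of_lt (by norm_num) hy0]
  refine mul_le_of_le_one_right (by positivity) ?_
  norm_num
  rw [Real.rpow_neg_one]
  exact inv_le_one_of_one_le₀ hy1

lemma integrableOn_mul (h : HasExpSqrtTail b f) {y : ℝ} (hyb : b ≤ y) (hy1 : 1 ≤ y) :
    IntegrableOn (fun lam => lam * f lam) (Ioi y) := by
  obtain ⟨A, -, hA⟩ := h.tail one_pos le_rfl
  exact (hA y hyb hy1).1

lemma power_integrand_le (h : HasExpSqrtTail b f) {x lam : ℝ} (hx1 : 1 ≤ x) (hl : x < lam) :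
    (1 / x - 1 / lam) * f lam ≤ lam * f lam := by
  refine mul_le_mul_of_nonneg_right ?_ (h.nonneg _)
  have h1 : 1 / x ≤ 1 := by rw [div_le_one (by linarith)]; exact hx1
  have h2 : 0 < 1 / lam := one_div_pos.2 (by linarith)
  linarith

lemma integrableOn_power (h : HasExpSqrtTail b f) {x : ℝ} (hxb : b ≤ x) (hx1 : 1 ≤ x) :
    IntegrableOn (fun lam => (1 / x - 1 / lam) * f lam) (Ioi x) := by
  have hm := h.meas
  refine Integrable.mono' (h.integrableOn_mul hxb hx1) (by fun_prop) ?_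
  filter_upwards [ae_restrict_mem measurableSet_Ioi] with lam hl
  rw [Real.norm_of_nonneg
    (mul_nonneg (inv_sub_inv_nonneg (by linarith) (le_of_lt hl)) (h.nonneg _))]
  exact h.power_integrand_le hx1 hl

lemma waterPower_upper (h : HasExpSqrtTail b f) {ε : ℝ} (hε : 0 < ε) (hε1 : ε ≤ 1) :
    ∃ A > 0, ∀ x, b ≤ x → 1 ≤ x → waterPower f x ≤ A * Real.exp (-((2 - ε) * √(x / b))) := by
  obtain ⟨A, hA, hAt⟩ := h.tail hε hε1
  refine ⟨A, hA, fun x hxb hx1 => le_trans ?_ (hAt x hxb hx1).2⟩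
  exact setIntegral_mono_on (h.integrableOn_power hxb hx1) (hAt x hxb hx1).1 measurableSet_Ioi
    fun lam hl => h.power_integrand_le hx1 hl

lemma waterPower_lower (h : HasExpSqrtTail b f) {ε : ℝ} (hε : 0 < ε) (hε1 : ε ≤ 1) :
    ∃ c > 0, ∀ x, b ≤ x → 1 ≤ x → c * Real.exp (-((2 + ε) * √(x / b))) ≤ waterPower f x := by
  obtain ⟨k, hk, hlow⟩ := h.lower (ε / 4) (by linarith)
  have hb := h.pos
  obtain ⟨ρ, hρ⟩ : ∃ ρ, ρ = 1 + ε / 4 := ⟨_, rfl⟩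
  have hρ1 : 1 < ρ := by linarith
  have hρi : 0 < 1 - 1 / ρ := by
    rw [sub_pos, div_lt_one (by linarith)]; exact hρ1
  refine ⟨(ρ ^ 2 - ρ) * ((1 - 1 / ρ) * k), by
    have : 0 < ρ ^ 2 - ρ := by nlinarith
    positivity, fun x hxb hx1 => ?_⟩
  have hx0 : 0 < x := by linarith
  have hρx : x < ρ * x := by nlinarith
  have hρx2 : ρ * x ≤ ρ ^ 2 * x := by nlinarith
  have hsub : Icc (ρ * x) (ρ ^ 2 * x) ⊆ Ioi x := fun t ht => hρx.trans_le ht.1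
  have hint := h.integrableOn_power hxb hx1
  have hnn : 0 ≤ᵐ[volume.restrict (Ioi x)] fun lam => (1 / x - 1 / lam) * f lam := by
    filter_upwards [ae_restrict_mem measurableSet_Ioi] with lam hl
    exact mul_nonneg (inv_sub_inv_nonneg hx0 (le_of_lt hl)) (h.nonneg _)
  have h1 := setIntegral_ge_of_const_le
    (c := (1 - 1 / ρ) / x * (k * Real.exp (-((2 + ε) * √(x / b)))))
    measurableSet_Icc (by simp) (fun lam hl => ?_) (hint.mono_set hsub)
  · refine le_trans (le_of_eq ?_) (h1.trans (setIntegral_mono_set hint hnn hsub.eventuallyLE))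
    rw [Real.volume_real_Icc_of_le hρx2, smul_eq_mul]
    field_simp
  · have hl0 : x < lam := hsub hl
    have h2 : (1 - 1 / ρ) / x ≤ 1 / x - 1 / lam := by
      have : 1 / lam ≤ 1 / (ρ * x) := one_div_le_one_div_of_le (by linarith) hl.1
      have e : (1 - 1 / ρ) / x = 1 / x - 1 / (ρ * x) := by field_simp
      linarith
    have h3 : √(lam / b) ≤ ρ * √(x / b) := by
      rw [← Real.sqrt_sq (by linarith : 0 ≤ ρ), ← Real.sqrt_mul (by positivity), ← mul_div_assoc]
      have := hl.2
      gcongr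
    refine mul_le_mul h2 ((mul_le_mul_of_nonneg_left ?_ hk.le).trans (hlow lam (by linarith)))
      (by positivity) (inv_sub_inv_nonneg hx0 hl0.le)
    rw [Real.exp_le_exp, neg_le_neg_iff]
    calc (2 + ε / 4) * √(lam / b) ≤ (2 + ε / 4) * (ρ * √(x / b)) := by gcongr
      _ = ((2 + ε / 4) * ρ) * √(x / b) := by ring
      _ ≤ _ := by
        gcongr
        rw [hρ]; nlinarith

lemma waterPower_pos (h : HasExpSqrtTail b f) {x : ℝ} (hxb : b ≤ x) (hx1 : 1 ≤ x) :
    0 < waterPower f x := by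
  obtain ⟨c, hc, hcl⟩ := h.waterPower_lower one_pos le_rfl
  exact lt_of_lt_of_le (by positivity) (hcl x hxb hx1)

lemma integrableOn_rate (h : HasExpSqrtTail b f) {x : ℝ} (hxb : b ≤ x) (hx1 : 1 ≤ x) :
    IntegrableOn (fun lam => Real.log (lam / x) * f lam) (Ioi x) := by
  have hm := h.meas
  have hx0 : 0 < x := by linarith
  refine Integrable.mono' (h.integrableOn_mul hxb hx1) (by fun_prop) ?_
  filter_upwards [ae_restrict_mem measurableSet_Ioi] with lam hl
  have hl : x < lam := hl
  have hl0 : 0 < lam := by linarith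
  rw [Real.norm_of_nonneg
    (mul_nonneg (Real.log_nonneg ((one_le_div hx0).2 hl.le)) (h.nonneg _))]
  refine mul_le_mul_of_nonneg_right ?_ (h.nonneg _)
  exact (Real.log_le_self (by positivity)).trans (div_le_self hl0.le hx1)

lemma mul_waterPower_le_waterRate (h : HasExpSqrtTail b f) {x : ℝ} (hxb : b ≤ x) (hx1 : 1 ≤ x) :
    x * waterPower f x ≤ waterRate f x := by
  rw [waterPower, ← integral_const_mul]
  refine setIntegral_mono_on ((h.integrableOn_power hxb hx1).const_mul _)
    (h.integrableOn_rate hxb hx1) measurableSet_Ioi fun lam (hl : x < lam) => ?_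
  have hx0 : 0 < x := by linarith
  have hl0 : 0 < lam := by linarith
  rw [← mul_assoc]
  refine mul_le_mul_of_nonneg_right (le_trans (le_of_eq ?_)
    (Real.one_sub_inv_le_log_of_pos (by positivity : 0 < lam / x))) (h.nonneg _)
  field_simp

lemma waterRate_upper (h : HasExpSqrtTail b f) {ρ : ℝ} (hρ : 1 < ρ) :
    ∃ A > 0, ∀ x, b ≤ x → 1 ≤ x → waterRate f x ≤
      ρ ^ 2 * x * waterPower f x + A * Real.exp (-((ρ - 1) * √(x / b))) * waterPower f x := by
  have hb := h.pos
  obtain ⟨ε, hε⟩ : ∃ ε, ε = (ρ - 1) / (ρ + 1) := ⟨_, rfl⟩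
  have hε0 : 0 < ε := hε ▸ div_pos (by linarith) (by linarith)
  have hε1 : ε ≤ 1 := by rw [hε, div_le_one (by linarith)]; linarith
  have hερ : ε * (ρ + 1) = ρ - 1 := by rw [hε]; field_simp
  obtain ⟨A, hA, htail⟩ := h.tail hε0 hε1
  obtain ⟨c, hc, hlow⟩ := h.waterPower_lower hε0 hε1
  refine ⟨A / c, by positivity, fun x hxb hx1 => ?_⟩
  have hx0 : 0 < x := by linarith
  have hρ2 : 1 < ρ ^ 2 := by nlinarith
  have hxy : x ≤ ρ ^ 2 * x := by nlinarith
  obtain ⟨hI, hT⟩ := htail (ρ ^ 2 * x) (hxb.trans hxy) (hx1.trans hxy)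
  have hP := (h.integrableOn_power hxb hx1).const_mul (ρ ^ 2 * x)
  have hind : Integrable ((Ioi (ρ ^ 2 * x)).indicator fun lam => lam * f lam)
      (volume.restrict (Ioi x)) := by
    rw [integrable_indicator_iff measurableSet_Ioi, IntegrableOn,
      Measure.restrict_restrict measurableSet_Ioi,
      inter_eq_left.2 (Ioi_subset_Ioi hxy)]
    exact hI
  have h1 : waterRate f x ≤
      ρ ^ 2 * x * waterPower f x + ∫ lam in Ioi (ρ ^ 2 * x), lam * f lam := by
    have e : ∫ lam in Ioi (ρ ^ 2 * x), lam * f lam =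
        ∫ lam in Ioi x, (Ioi (ρ ^ 2 * x)).indicator (fun lam => lam * f lam) lam := by
      rw [setIntegral_indicator measurableSet_Ioi, inter_eq_right.2 (Ioi_subset_Ioi hxy)]
    rw [e, waterPower, ← integral_const_mul, ← integral_add hP hind]
    refine setIntegral_mono_on (h.integrableOn_rate hxb hx1) (hP.add hind) measurableSet_Ioi
      fun lam (hl : x < lam) => ?_
    have hl0 : 0 < lam := by linarith
    have hf0 := h.nonneg lam
    have hd := inv_sub_inv_nonneg hx0 hl.le
    by_cases hm : ρ ^ 2 * x < lam
    · rw [indicator_of_mem (by exact hm)]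
      have : Real.log (lam / x) ≤ lam :=
        (Real.log_le_self (by positivity)).trans (div_le_self hl0.le hx1)
      have h2 : 0 ≤ ρ ^ 2 * x * ((1 / x - 1 / lam) * f lam) := by positivity
      have h3 := mul_le_mul_of_nonneg_right this hf0
      linarith
    · rw [indicator_of_notMem (by exact hm), add_zero, ← mul_assoc]
      refine mul_le_mul_of_nonneg_right ?_ hf0
      calc Real.log (lam / x) ≤ lam / x - 1 := Real.log_le_sub_one_of_pos (by positivity)
        _ = lam * (1 / x - 1 / lam) := by field_simp
        _ ≤ _ := by
          have := not_lt.1 hm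
          gcongr
  have h2 : √(ρ ^ 2 * x / b) = ρ * √(x / b) := by
    rw [mul_div_assoc, Real.sqrt_mul (by positivity), Real.sqrt_sq (by linarith)]
  rw [h2] at hT
  refine h1.trans (add_le_add_right (hT.trans ?_) _)
  have h3 := hlow x hxb hx1
  calc A * Real.exp (-((2 - ε) * (ρ * √(x / b))))
      = A / c * Real.exp (-((ρ - 1) * √(x / b))) * (c * Real.exp (-((2 + ε) * √(x / b)))) := by
        have e : -((2 - ε) * (ρ * √(x / b))) = -((ρ - 1) * √(x / b)) + -((2 + ε) * √(x / b)) := by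
          linear_combination √(x / b) * hερ
        rw [e, Real.exp_add]; field_simp
    _ ≤ _ := by gcongr

lemma tendsto_sqrt_div (h : HasExpSqrtTail b f) :
    Tendsto (fun x : ℝ => √(x / b)) atTop atTop :=
  Real.tendsto_sqrt_atTop.comp (tendsto_id.atTop_div_const h.pos)

lemma tendsto_waterRate_div (h : HasExpSqrtTail b f) :
    Tendsto (fun x => waterRate f x / (x * waterPower f x)) atTop (𝓝 1) := by
  refine tendsto_order.2 ⟨fun a ha => ?_, fun a ha => ?_⟩
  · filter_upwards [eventually_ge_atTop b, eventually_ge_atTop 1] with x hxb hx1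
    refine ha.trans_le ?_
    rw [one_le_div (mul_pos (by linarith) (h.waterPower_pos hxb hx1))]
    exact h.mul_waterPower_le_waterRate hxb hx1
  · have hρ : 1 < √((1 + a) / 2) := by rw [Real.lt_sqrt zero_le_one]; linarith
    obtain ⟨A, hA, hup⟩ := h.waterRate_upper hρ
    rw [Real.sq_sqrt (by linarith)] at hup
    have hlim : Tendsto (fun x => A * Real.exp (-((√((1 + a) / 2) - 1) * √(x / b)))) atTop
        (𝓝 (A * 0)) :=
      (Real.tendsto_exp_neg_atTop_nhds_zero.comp
        (h.tendsto_sqrt_div.const_mul_atTop (sub_pos.2 hρ))).const_mul A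
    rw [mul_zero] at hlim
    filter_upwards [eventually_ge_atTop b, eventually_ge_atTop 1,
      hlim.eventually_lt_const (by linarith : 0 < (a - 1) / 2)] with x hxb hx1 hx
    have hF := h.waterPower_pos hxb hx1
    rw [div_lt_iff₀ (mul_pos (by linarith) hF)]
    refine (hup x hxb hx1).trans_lt ?_
    have h1 := mul_lt_mul_of_pos_right hx hF
    have h2 : (a - 1) / 2 * waterPower f x ≤ (a - 1) / 2 * (x * waterPower f x) := by
      have : 0 < (a - 1) / 2 := by linarith
      gcongr
      exact le_mul_of_one_le_left hF.le hx1
    linarith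

lemma tendsto_log_waterPower (h : HasExpSqrtTail b f) :
    Tendsto (fun x => Real.log (1 / waterPower f x) / √(x / b)) atTop (𝓝 2) := by
  have hb := h.pos
  refine tendsto_order.2 ⟨fun a ha => ?_, fun a ha => ?_⟩
  · have hε : 0 < min 1 ((2 - a) / 2) := lt_min one_pos (by linarith)
    have hε2 : min 1 ((2 - a) / 2) ≤ (2 - a) / 2 := min_le_right _ _
    obtain ⟨A, hA, hup⟩ := h.waterPower_upper hε (min_le_left _ _)
    set ε := min 1 ((2 - a) / 2)
    filter_upwards [eventually_ge_atTop b, eventually_ge_atTop 1,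
      h.tendsto_sqrt_div.eventually_gt_atTop (Real.log A / ((2 - a) / 2))] with x hxb hx1 hx
    have hF := h.waterPower_pos hxb hx1
    have hr := one_le_sqrt_div hb hxb
    have h1 := Real.log_le_log hF (hup x hxb hx1)
    rw [Real.log_mul hA.ne' (Real.exp_ne_zero _), Real.log_exp] at h1
    rw [div_lt_iff₀ (by linarith)] at hx
    rw [one_div, Real.log_inv, lt_div_iff₀ (by linarith)]
    have := mul_le_mul_of_nonneg_right hε2 (by linarith : 0 ≤ √(x / b))
    linarith
  · have hε : 0 < min 1 ((a - 2) / 2) := lt_min one_pos (by linarith)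
    have hε2 : min 1 ((a - 2) / 2) ≤ (a - 2) / 2 := min_le_right _ _
    obtain ⟨c, hc, hlow⟩ := h.waterPower_lower hε (min_le_left _ _)
    set ε := min 1 ((a - 2) / 2)
    filter_upwards [eventually_ge_atTop b, eventually_ge_atTop 1,
      h.tendsto_sqrt_div.eventually_gt_atTop (-Real.log c / ((a - 2) / 2))] with x hxb hx1 hx
    have hr := one_le_sqrt_div hb hxb
    have h1 := Real.log_le_log (by positivity) (hlow x hxb hx1)
    rw [Real.log_mul hc.ne' (Real.exp_ne_zero _), Real.log_exp] at h1
    rw [div_lt_iff₀ (by linarith)] at hx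
    rw [one_div, Real.log_inv, div_lt_iff₀ (by linarith)]
    have := mul_le_mul_of_nonneg_right hε2 (by linarith : 0 ≤ √(x / b))
    linarith

lemma tendsto_threshold (h : HasExpSqrtTail b f) {x : ℝ → ℝ} (hx : ∀ s > 0, 0 < x s)
    (hpow : ∀ s > 0, waterPower f (x s) = s) : Tendsto x (𝓝[>] 0) atTop := by
  refine tendsto_atTop.2 fun M => ?_
  obtain ⟨N, hMN, hbN, hN1⟩ : ∃ N, M ≤ N ∧ b ≤ N ∧ 1 ≤ N :=
    ⟨max M (max b 1), by simp, by simp, by simp⟩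
  filter_upwards [Ioo_mem_nhdsGT (h.waterPower_pos hbN hN1)] with s ⟨hs0, hsN⟩
  by_contra! hlt
  have hxN : x s ≤ N := by linarith
  have hx0 := hx s hs0
  have hI : IntegrableOn (fun lam => (1 / x s - 1 / lam) * f lam) (Ioi (x s)) :=
    Integrable.of_integral_ne_zero ((hpow s hs0).trans_ne hs0.ne')
  have h1 : waterPower f N ≤ waterPower f (x s) := by
    refine (setIntegral_mono_on (h.integrableOn_power hbN hN1)
      (hI.mono_set (Ioi_subset_Ioi hxN)) measurableSet_Ioi fun lam _ => ?_).trans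
      (setIntegral_mono_set hI ?_ (Ioi_subset_Ioi hxN).eventuallyLE)
    · have := one_div_le_one_div_of_le hx0 hxN
      exact mul_le_mul_of_nonneg_right (by linarith) (h.nonneg _)
    · filter_upwards [ae_restrict_mem measurableSet_Ioi] with lam hl
      exact mul_nonneg (inv_sub_inv_nonneg hx0 (le_of_lt hl)) (h.nonneg _)
  rw [hpow s hs0] at h1
  linarith

theorem tendsto_capacity (h : HasExpSqrtTail b f) {x : ℝ → ℝ} (hx : ∀ s > 0, 0 < x s)
    (hpow : ∀ s > 0, waterPower f (x s) = s) :
    Tendsto (fun s => waterRate f (x s) / (b * (s / 4) * Real.log (1 / s) ^ 2))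
      (𝓝[>] 0) (𝓝 1) := by
  have hb := h.pos
  have hxt := h.tendsto_threshold hx hpow
  have hlim := (h.tendsto_waterRate_div.comp hxt).mul
    ((((h.tendsto_log_waterPower.comp hxt).inv₀ two_ne_zero).const_mul 2).pow 2)
  norm_num at hlim
  refine hlim.congr' ?_
  filter_upwards [self_mem_nhdsWithin] with s hs
  have hs : 0 < s := hs
  have hx0 := hx s hs
  simp only [hpow s hs]
  have e := Real.sq_sqrt (by positivity : 0 ≤ x s / b)
  simp only [one_div, Real.log_inv, mul_pow, div_pow, neg_sq, e]
  field_simp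
  norm_num

end HasExpSqrtTail

lemma hasExpSqrtTail_gammaProdDen {m₁ m₂ θ₁ θ₂ : ℝ} (hm₁ : 0 < m₁) (hm₂ : 0 < m₂) (hθ₁ : 0 < θ₁)
    (hθ₂ : 0 < θ₂) : HasExpSqrtTail (θ₁ * θ₂) (gammaProdDen m₁ m₂ θ₁ θ₂) where
  pos := mul_pos hθ₁ hθ₂
  meas := measurable_gammaProdDen _ _ _ _
  nonneg _ := gammaProdDen_nonneg hm₁ hm₂ hθ₁ hθ₂
  lower _ hε := gammaProdDen_lower hm₁ hm₂ hθ₁ hθ₂ hε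
  upper _ hε hε1 := gammaProdDen_upper hm₁ hm₂ hθ₁ hθ₂ hε hε1

/-- Theorem 1 of the paper: under full CSI, the low-SNR water-filling capacity of the
double-Nakagami-m pinhole channel satisfies
`C ≈ (Ω_T Ω_R/(m_T m_R)) · (SNR/4) · log²(1/SNR)`. -/
theorem lowSNR_capacity_double_nakagami
    (mT mR ΩT ΩR : ℝ) (hmT : 1 / 2 ≤ mT) (hmR : 1 / 2 ≤ mR)
    (hΩT : 0 < ΩT) (hΩR : 0 < ΩR)
    (b : ℝ) (hb : b = ΩT * ΩR / (mT * mR))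
    (f : ℝ → ℝ)
    (hf : ∀ lam > (0 : ℝ), f lam =
      ∫ z in Ioi (0 : ℝ),
        gammaDen mT (ΩT / mT) z * gammaDen mR (ΩR / mR) (lam / z) * z⁻¹)
    (x : ℝ → ℝ) (hxpos : ∀ s > (0 : ℝ), 0 < x s)
    (hpow : ∀ s > (0 : ℝ),
      (∫ lam in Ioi (x s), (1 / x s - 1 / lam) * f lam) = s)
    (C : ℝ → ℝ)
    (hC : ∀ s > (0 : ℝ), C s = ∫ lam in Ioi (x s), Real.log (lam / x s) * f lam) :
    Tendsto (fun s => C s / (b * (s / 4) * Real.log (1 / s) ^ 2))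
      (𝓝[>] (0 : ℝ)) (𝓝 1) := by
  have hmT0 : 0 < mT := by linarith
  have hmR0 : 0 < mR := by linarith
  have h := hasExpSqrtTail_gammaProdDen hmT0 hmR0 (div_pos hΩT hmT0) (div_pos hΩR hmR0)
  rw [div_mul_div_comm, ← hb] at h
  have hfeq : ∀ s > 0, ∀ lam ∈ Ioi (x s), f lam = gammaProdDen mT mR (ΩT / mT) (ΩR / mR) lam :=
    fun s hs lam hl => hf lam ((hxpos s hs).trans hl)
  refine (h.tendsto_capacity hxpos fun s hs => ?_).congr' ?_
  · refine Eq.trans (setIntegral_congr_fun measurableSet_Ioi fun lam hl => ?_) (hpow s hs)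
    simp only [hfeq s hs lam hl]
  · filter_upwards [self_mem_nhdsWithin] with s (hs : 0 < s)
    rw [hC s hs]
    congr 1
    refine setIntegral_congr_fun measurableSet_Ioi fun lam hl => ?_
    simp only [hfeq s hs lam hl]
end

section
/- Let m_1, m_2 > 0 and define f(λ) = ∫_0^∞ g_{m_1,1}(z) · g_{m_2,1}(λ/z) · z^{-1} dz for λ > 0. Then f(λ) / ( (√π/(Γ(m_1)Γ(m_2))) · λ^{(m_1+m_2)/2 − 5/4} · e^{−2√λ} ) → 1 as λ → ∞. -/
open MeasureTheory Filter Set Topology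

/-- The rescaled phase of the Laplace integral converges pointwise to a parabola. -/
lemma tendsto_sq_mul_sinh_sq (u : ℝ) :
    Tendsto (fun r : ℝ => (r * (2 * Real.sinh (u / r / 2))) ^ 2) atTop (𝓝 (u ^ 2)) := by
  have hd : HasDerivAt (fun x : ℝ => 2 * Real.sinh (u * x / 2)) u 0 := by
    have h1 : HasDerivAt (fun x : ℝ => u * x / 2) (u / 2) 0 := by
      simpa using ((hasDerivAt_id (0 : ℝ)).const_mul u).div_const 2
    have h2 := h1.sinh.const_mul 2
    simpa [mul_div_cancel₀] using h2
  have h := (hd.tendsto_slope_zero_right.comp tendsto_inv_atTop_nhdsGT_zero).pow 2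
  refine h.congr fun r => ?_
  simp [div_eq_mul_inv]

lemma sq_le_sq_mul_sinh_sq {r : ℝ} (hr : 0 < r) (u : ℝ) :
    u ^ 2 ≤ (r * (2 * Real.sinh (u / r / 2))) ^ 2 := by
  have key : ∀ x : ℝ, x ^ 2 ≤ Real.sinh x ^ 2 := fun x => by
    rw [sq_le_sq, Real.abs_sinh]
    exact Real.self_le_sinh_iff.2 (abs_nonneg x)
  have h := key (u / r / 2)
  calc u ^ 2 = 4 * r ^ 2 * (u / r / 2) ^ 2 := by field_simp; ring
    _ ≤ 4 * r ^ 2 * Real.sinh (u / r / 2) ^ 2 := by gcongr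
    _ = _ := by ring

lemma tendsto_integral_exp_sinh_sq (ν : ℝ) :
    Tendsto (fun r : ℝ => ∫ u : ℝ,
        Real.exp (ν * (u / r) - (r * (2 * Real.sinh (u / r / 2))) ^ 2))
      atTop (𝓝 (Real.sqrt Real.pi)) := by
  have hg : ∫ u : ℝ, Real.exp (-1 * u ^ 2) = Real.sqrt Real.pi := by
    rw [integral_gaussian, div_one]
  rw [← hg]
  refine tendsto_integral_filter_of_dominated_convergence
    (fun u => Real.exp (ν ^ 2 / 2) * Real.exp (-(1 / 2) * u ^ 2)) ?_ ?_ ?_ ?_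
  · exact Eventually.of_forall fun r => by
      refine Measurable.aestronglyMeasurable ?_
      have := Real.continuous_sinh.measurable
      fun_prop
  · filter_upwards [eventually_ge_atTop 1] with r hr
    refine Eventually.of_forall fun u => ?_
    have hr0 : 0 < r := by linarith
    rw [Real.norm_eq_abs, Real.abs_exp, ← Real.exp_add, Real.exp_le_exp]
    have h1 := sq_le_sq_mul_sinh_sq hr0 u
    have h2 : (u / r) ^ 2 ≤ u ^ 2 := by
      rw [div_pow]
      exact div_le_self (sq_nonneg u) (one_le_pow₀ hr)
    nlinarith [sq_nonneg (ν - u / r)]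
  · exact (integrable_exp_neg_mul_sq (by norm_num)).const_mul _
  · refine Eventually.of_forall fun u => ?_
    refine (Real.continuous_exp.tendsto _).comp ?_
    have h1 : Tendsto (fun r : ℝ => ν * (u / r)) atTop (𝓝 (ν * 0)) :=
      (tendsto_id.const_div_atTop u).const_mul ν
    convert h1.sub (tendsto_sq_mul_sinh_sq u) using 2
    ring

/-- Change of variables `z = r² exp (u / r)` on the half-line. -/
lemma integral_Ioi_eq_integral_sq_mul_exp_div {r : ℝ} (hr : 0 < r) (g : ℝ → ℝ) :
    ∫ z in Ioi (0 : ℝ), g z =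
      ∫ u : ℝ, r * Real.exp (u / r) * g (r ^ 2 * Real.exp (u / r)) := by
  have himg : (fun u : ℝ => r ^ 2 * Real.exp (u / r)) '' univ = Ioi 0 := by
    ext z
    simp only [image_univ, mem_range, mem_Ioi]
    constructor
    · rintro ⟨u, rfl⟩
      positivity
    · intro hz
      refine ⟨r * Real.log (z / r ^ 2), ?_⟩
      rw [mul_div_cancel_left₀ _ hr.ne', Real.exp_log (by positivity)]
      field_simp
  have hd : ∀ u ∈ (univ : Set ℝ), HasDerivWithinAt (fun u : ℝ => r ^ 2 * Real.exp (u / r))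
      (r * Real.exp (u / r)) univ u := fun u _ => by
    refine HasDerivAt.hasDerivWithinAt ?_
    refine (((hasDerivAt_id u).div_const r).exp.const_mul (r ^ 2)).congr_deriv ?_
    simp only [id]
    field_simp
  have hinj : InjOn (fun u : ℝ => r ^ 2 * Real.exp (u / r)) univ := fun a _ b _ hab => by
    have h1 := Real.exp_injective (mul_left_cancel₀ (pow_ne_zero 2 hr.ne') hab)
    exact (div_left_inj' hr.ne').1 h1
  rw [← himg, integral_image_eq_integral_abs_deriv_smul MeasurableSet.univ hd hinj,
    Measure.restrict_univ]
  refine integral_congr_ae (Eventually.of_forall fun u => ?_)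
  simp only [smul_eq_mul]
  rw [abs_of_pos (by positivity)]

lemma gammaDen_one_exp (m x : ℝ) :
    gammaDen m 1 (Real.exp x) = Real.exp ((m - 1) * x - Real.exp x) / Real.Gamma m := by
  rw [gammaDen, if_pos (Real.exp_pos x), ← Real.exp_mul, ← Real.exp_add, Real.one_rpow, mul_one]
  congr 2
  ring

lemma gammaDen_mul_gammaDen_rescaled (m₁ m₂ L u : ℝ) :
    Real.exp L * Real.exp (u / Real.exp L) *
      (gammaDen m₁ 1 (Real.exp L ^ 2 * Real.exp (u / Real.exp L)) *
        gammaDen m₂ 1 (Real.exp (4 * L) / (Real.exp L ^ 2 * Real.exp (u / Real.exp L))) *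
        (Real.exp L ^ 2 * Real.exp (u / Real.exp L))⁻¹) =
    Real.exp ((2 * (m₁ + m₂) - 5) * L - 2 * Real.exp L ^ 2) /
        (Real.Gamma m₁ * Real.Gamma m₂) *
      Real.exp ((m₁ - m₂) * (u / Real.exp L) -
        (Real.exp L * (2 * Real.sinh (u / Real.exp L / 2))) ^ 2) := by
  set t := u / Real.exp L
  have hz : Real.exp L ^ 2 * Real.exp t = Real.exp (2 * L + t) := by
    rw [← Real.exp_nat_mul, ← Real.exp_add]
    norm_num
  have hs : (Real.exp L * (2 * Real.sinh (t / 2))) ^ 2 =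
      Real.exp (2 * L + t) + Real.exp (2 * L - t) - 2 * Real.exp L ^ 2 := by
    have e1 : Real.exp (2 * L + t) = Real.exp L ^ 2 * Real.exp (t / 2) ^ 2 := by
      simp only [← Real.exp_nat_mul, ← Real.exp_add]
      congr 1
      push_cast
      ring
    have e2 : Real.exp (2 * L - t) = Real.exp L ^ 2 * Real.exp (-(t / 2)) ^ 2 := by
      simp only [← Real.exp_nat_mul, ← Real.exp_add]
      congr 1
      push_cast
      ring
    have e3 : Real.exp (t / 2) * Real.exp (-(t / 2)) = 1 := by
      rw [← Real.exp_add, add_neg_cancel, Real.exp_zero]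
    rw [e1, e2, Real.sinh_eq]
    linear_combination (-2 * Real.exp L ^ 2) * e3
  have hq : Real.exp (4 * L) / Real.exp (2 * L + t) = Real.exp (2 * L - t) := by
    rw [← Real.exp_sub]
    congr 1
    ring
  rw [hz, hq, hs, gammaDen_one_exp, gammaDen_one_exp, ← Real.exp_neg, ← Real.exp_add,
    div_mul_div_comm, ← Real.exp_add, div_mul_eq_mul_div, div_mul_eq_mul_div, ← mul_div_assoc,
    ← Real.exp_add, ← Real.exp_add, ← Real.exp_add]
  congr 2
  ring

/-- Tail approximation of the double-Gamma (double-Nakagami-m) pinhole channel gain density: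
`f(λ) ~ (√π/(Γ(m₁)Γ(m₂))) · λ^{(m₁+m₂)/2−5/4} · e^{−2√λ}` as `λ → ∞`. -/
theorem product_gamma_density_tail_asymptotic
    (m₁ m₂ : ℝ) (hm₁ : 0 < m₁) (hm₂ : 0 < m₂)
    (f : ℝ → ℝ)
    (hf : ∀ lam > (0 : ℝ), f lam =
      ∫ z in Ioi (0 : ℝ), gammaDen m₁ 1 z * gammaDen m₂ 1 (lam / z) * z⁻¹) :
    Tendsto (fun lam => f lam /
        (Real.sqrt Real.pi / (Real.Gamma m₁ * Real.Gamma m₂) *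
          lam ^ ((m₁ + m₂) / 2 - 5 / 4) * Real.exp (-2 * Real.sqrt lam)))
      atTop (𝓝 1) := by
  have hΓ₁ := Real.Gamma_pos_of_pos hm₁
  have hΓ₂ := Real.Gamma_pos_of_pos hm₂
  have hπ : Real.sqrt Real.pi ≠ 0 := (Real.sqrt_pos.2 Real.pi_pos).ne'
  have hr : Tendsto (fun lam : ℝ => Real.exp (Real.log lam / 4)) atTop atTop :=
    Real.tendsto_exp_atTop.comp (Real.tendsto_log_atTop.atTop_div_const (by norm_num))
  have hlim := ((tendsto_integral_exp_sinh_sq (m₁ - m₂)).comp hr).div_const (Real.sqrt Real.pi)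
  rw [div_self hπ] at hlim
  refine hlim.congr' ?_
  filter_upwards [eventually_gt_atTop 0] with lam hlam
  obtain ⟨L, rfl⟩ : ∃ L, lam = Real.exp (4 * L) :=
    ⟨Real.log lam / 4, by rw [mul_div_cancel₀ _ (by norm_num), Real.exp_log hlam]⟩
  have hsqrt : Real.sqrt (Real.exp (4 * L)) = Real.exp L ^ 2 := by
    rw [Real.sqrt_eq_iff_mul_self_eq (by positivity) (by positivity)]
    simp only [← Real.exp_nat_mul, ← Real.exp_add]
    congr 1
    push_cast
    ring
  have hexp : Real.exp (4 * L) ^ ((m₁ + m₂) / 2 - 5 / 4) * Real.exp (-2 * Real.exp L ^ 2) =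
      Real.exp ((2 * (m₁ + m₂) - 5) * L - 2 * Real.exp L ^ 2) := by
    rw [← Real.exp_mul, ← Real.exp_add]
    congr 1
    ring
  rw [hf _ hlam, integral_Ioi_eq_integral_sq_mul_exp_div (Real.exp_pos L)]
  simp only [gammaDen_mul_gammaDen_rescaled, Function.comp_apply, Real.log_exp]
  rw [integral_const_mul, hsqrt, mul_assoc (Real.sqrt Real.pi / _), hexp,
    mul_div_cancel_left₀ L (by norm_num : (4 : ℝ) ≠ 0)]
  field_simp
end

section
/- For every real a, the integral J(x) = ∫_x^∞ log(λ/x) · λ^a · e^{−2√λ} dλ satisfies J(x) / ( x^a e^{−2√x} ) → 1 as x → ∞. -/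
open MeasureTheory Filter Set Topology

/-- The substitution `λ = (y + s)²` with `y = √x`. -/
lemma setIntegral_Ioi_sq_eq_setIntegral_comp_add_sq (g : ℝ → ℝ) {y : ℝ} (hy : 0 < y) :
    ∫ lam in Ioi (y ^ 2), g lam = ∫ s in Ioi (0 : ℝ), 2 * (y + s) * g ((y + s) ^ 2) := by
  have himage : (fun s : ℝ => (y + s) ^ 2) '' Ioi 0 = Ioi (y ^ 2) := by
    ext t
    simp only [mem_image, mem_Ioi]
    constructor
    · rintro ⟨s, hs, rfl⟩
      nlinarith
    · intro ht
      refine ⟨√t - y, ?_, ?_⟩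
      · linarith [Real.lt_sqrt_of_sq_lt ht]
      · rw [add_sub_cancel, Real.sq_sqrt (by nlinarith)]
  have hderiv : ∀ s ∈ Ioi (0 : ℝ),
      HasDerivWithinAt (fun s : ℝ => (y + s) ^ 2) (2 * (y + s)) (Ioi 0) s := by
    intro s _
    have h := ((hasDerivAt_id s).const_add y).pow 2
    simp only [id, Nat.cast_ofNat, Nat.add_one_sub_one, pow_one, mul_one] at h
    exact h.hasDerivWithinAt
  have hinj : InjOn (fun s : ℝ => (y + s) ^ 2) (Ioi 0) := by
    intro s hs t ht hst
    simp only [mem_Ioi] at hs ht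
    have := (sq_eq_sq₀ (by positivity) (by positivity)).1 hst
    linarith
  rw [← himage, integral_image_eq_integral_abs_deriv_smul measurableSet_Ioi hderiv hinj]
  refine setIntegral_congr_fun measurableSet_Ioi fun s hs => ?_
  have hs : 0 < s := hs
  simp only [smul_eq_mul]
  rw [abs_of_pos (by positivity)]

lemma capacity_integral_div_eq (a : ℝ) {y : ℝ} (hy : 0 < y) :
    (∫ lam in Ioi (y ^ 2), Real.log (lam / y ^ 2) * lam ^ a * Real.exp (-2 * √lam)) /
        ((y ^ 2) ^ a * Real.exp (-2 * y)) =
      ∫ s in Ioi (0 : ℝ),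
        4 * (y * Real.log (1 + s / y)) * (1 + s / y) ^ (2 * a + 1) * Real.exp (-2 * s) := by
  rw [setIntegral_Ioi_sq_eq_setIntegral_comp_add_sq _ hy, ← integral_div]
  refine setIntegral_congr_fun measurableSet_Ioi fun s hs => ?_
  have hs : 0 < s := hs
  have hu : 0 < 1 + s / y := by positivity
  have hys : y + s = y * (1 + s / y) := by field_simp
  have hdiv : (y + s) ^ 2 / y ^ 2 = (1 + s / y) ^ 2 := by rw [hys]; field_simp
  have hpow : ((y + s) ^ 2) ^ a = (y ^ 2) ^ a * (1 + s / y) ^ (2 * a) := by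
    rw [hys, mul_pow, Real.mul_rpow (by positivity) (by positivity), Real.rpow_mul hu.le,
      Real.rpow_two]
  have hexp : Real.exp (-2 * (y + s)) = Real.exp (-2 * y) * Real.exp (-2 * s) := by
    rw [← Real.exp_add]; ring_nf
  have hy2 : (y ^ 2) ^ a ≠ 0 := (Real.rpow_pos_of_pos (by positivity) _).ne'
  rw [hdiv, hpow, Real.sqrt_sq (by positivity), hexp, Real.log_pow, Real.rpow_add_one hu.ne', hys]
  generalize 1 + s / y = u
  have := Real.exp_ne_zero (-2 * y)
  push_cast
  field_simp
  ring

lemma integrableOn_one_add_rpow_mul_exp (c : ℝ) :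
    IntegrableOn (fun s : ℝ => 4 * s * (1 + s) ^ c * Real.exp (-2 * s)) (Ioi 0) := by
  refine integrable_of_isBigO_exp_neg (b := 1) one_pos ?_ ?_
  · refine ContinuousOn.mul (ContinuousOn.mul (by fun_prop) ?_) (by fun_prop)
    refine ContinuousOn.rpow_const (by fun_prop) fun s hs => Or.inl ?_
    have hs : 0 ≤ s := hs
    positivity
  · have h : (fun s : ℝ => (1 + s) ^ (c + 1)) =O[atTop] fun s => Real.exp s := by
      have h0 := ((isLittleO_rpow_exp_atTop (c + 1)).comp_tendsto
        (tendsto_atTop_add_const_left atTop (1 : ℝ) tendsto_id)).isBigO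
      refine h0.trans (Asymptotics.IsBigO.of_bound (Real.exp 1) (Eventually.of_forall fun s => ?_))
      simp [Real.exp_add]
    refine (Asymptotics.IsBigO.of_bound 4 ?_).trans
      ((h.mul (Asymptotics.isBigO_refl (fun s : ℝ => Real.exp (-2 * s)) atTop)).trans
        (Asymptotics.IsBigO.of_bound 1 (Eventually.of_forall fun s => ?_)))
    · filter_upwards [eventually_ge_atTop 0] with s hs
      have h1 : (0 : ℝ) < 1 + s := by positivity
      rw [Real.rpow_add_one h1.ne', Real.norm_of_nonneg (by positivity),
        Real.norm_of_nonneg (by positivity)]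
      have : 0 ≤ (1 + s) ^ c * Real.exp (-2 * s) := by positivity
      nlinarith
    · rw [← Real.exp_add, one_mul]
      ring_nf
      exact le_rfl

lemma integral_four_mul_mul_exp :
    ∫ s in Ioi (0 : ℝ), 4 * s * Real.exp (-2 * s) = 1 := by
  have h := Real.integral_rpow_mul_exp_neg_mul_Ioi (a := 2) (r := 2) two_pos two_pos
  have h2 : ∫ s in Ioi (0 : ℝ), 4 * s * Real.exp (-2 * s) =
      ∫ s in Ioi (0 : ℝ), 4 * (s ^ ((2 : ℝ) - 1) * Real.exp (-(2 * s))) := by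
    congr 1
    ext s
    norm_num
    ring
  rw [h2, integral_const_mul, h, Real.Gamma_two]
  norm_num

lemma tendsto_integral_mul_log_one_add_div (c : ℝ) :
    Tendsto (fun y : ℝ => ∫ s in Ioi (0 : ℝ),
      4 * (y * Real.log (1 + s / y)) * (1 + s / y) ^ c * Real.exp (-2 * s)) atTop (𝓝 1) := by
  suffices h : Tendsto (fun y : ℝ => ∫ s in Ioi (0 : ℝ),
      4 * (y * Real.log (1 + s / y)) * (1 + s / y) ^ c * Real.exp (-2 * s)) atTop
      (𝓝 (∫ s in Ioi (0 : ℝ), 4 * s * Real.exp (-2 * s))) by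
    rwa [integral_four_mul_mul_exp] at h
  refine tendsto_integral_filter_of_dominated_convergence _ ?_ ?_
    (integrableOn_one_add_rpow_mul_exp |c|) ?_
  · exact Eventually.of_forall fun y => Measurable.aestronglyMeasurable (by fun_prop)
  · filter_upwards [eventually_ge_atTop 1] with y hy
    filter_upwards [ae_restrict_mem measurableSet_Ioi] with s hs
    have hs : 0 < s := hs
    have hy0 : 0 < y := by linarith
    have hsy : 0 < s / y := by positivity
    have hlog : 0 ≤ Real.log (1 + s / y) := Real.log_nonneg (by linarith)
    rw [Real.norm_of_nonneg (by positivity)]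
    have hlog_le : y * Real.log (1 + s / y) ≤ s := by
      have := Real.log_le_sub_one_of_pos (x := 1 + s / y) (by positivity)
      calc y * Real.log (1 + s / y) ≤ y * (s / y) := by gcongr; linarith
        _ = s := by field_simp
    have hpow_le : (1 + s / y) ^ c ≤ (1 + s) ^ |c| :=
      (Real.rpow_le_rpow_of_exponent_le (by linarith) (le_abs_self c)).trans
        (Real.rpow_le_rpow (by positivity) (by linarith [div_le_self hs.le hy]) (abs_nonneg c))
    gcongr
  · refine Eventually.of_forall fun s => ?_
    have hbase : Tendsto (fun y : ℝ => 1 + s / y) atTop (𝓝 1) := by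
      simpa using (tendsto_id.const_div_atTop s).const_add (1 : ℝ)
    have hpow : Tendsto (fun y : ℝ => (1 + s / y) ^ c) atTop (𝓝 1) := by
      simpa using hbase.rpow_const (p := c) (Or.inl one_ne_zero)
    simpa using (((Real.tendsto_mul_log_one_add_div_atTop s).const_mul 4).mul hpow).mul_const
      (Real.exp (-2 * s))

/-- Large-cutoff asymptotic of the capacity integral (eqs. (14)–(16) of the paper):
`∫_x^∞ log(λ/x) λ^a e^{−2√λ} dλ ~ x^a e^{−2√x}` as `x → ∞`. -/
theorem capacity_integral_asymptotic (a : ℝ) :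
    Tendsto (fun x : ℝ =>
        (∫ lam in Ioi x, Real.log (lam / x) * lam ^ a * Real.exp (-2 * Real.sqrt lam)) /
          (x ^ a * Real.exp (-2 * Real.sqrt x)))
      atTop (𝓝 1) := by
  refine ((tendsto_integral_mul_log_one_add_div (2 * a + 1)).comp
    Real.tendsto_sqrt_atTop).congr' ?_
  filter_upwards [eventually_gt_atTop 0] with x hx
  have h := capacity_integral_div_eq a (Real.sqrt_pos.2 hx)
  rw [Real.sq_sqrt hx.le] at h
  exact h.symm
end

section
/- For every real a, the integral H(x) = ∫_x^∞ (1/x − 1/λ) · λ^a · e^{−2√λ} dλ satisfies H(x) / ( x^{a−1} e^{−2√x} ) → 1 as x → ∞. -/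
open MeasureTheory Filter Set Topology

/-- The profile `x ^ s * e ^ (-2 √x)`. -/
noncomputable def rpowExpSqrt (s x : ℝ) : ℝ := x ^ s * Real.exp (-2 * Real.sqrt x)

lemma rpowExpSqrt_pos (s : ℝ) {x : ℝ} (hx : 0 < x) : 0 < rpowExpSqrt s x := by
  unfold rpowExpSqrt
  positivity

lemma rpow_mul_rpowExpSqrt (r s : ℝ) {x : ℝ} (hx : 0 < x) :
    x ^ r * rpowExpSqrt s x = rpowExpSqrt (r + s) x := by
  simp only [rpowExpSqrt, Real.rpow_add hx, mul_assoc]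

lemma mul_rpowExpSqrt (s : ℝ) {x : ℝ} (hx : 0 < x) :
    x * rpowExpSqrt s x = rpowExpSqrt (1 + s) x := by
  simpa using rpow_mul_rpowExpSqrt 1 s hx

lemma tendsto_rpowExpSqrt (s : ℝ) : Tendsto (rpowExpSqrt s) atTop (𝓝 0) := by
  refine ((tendsto_rpow_mul_exp_neg_mul_atTop_nhds_zero (2 * s) 2 two_pos).comp
    Real.tendsto_sqrt_atTop).congr' ?_
  filter_upwards [eventually_gt_atTop 0] with x hx
  simp only [rpowExpSqrt, Function.comp_apply]
  rw [Real.rpow_mul (Real.sqrt_nonneg x), Real.rpow_two, Real.sq_sqrt hx.le]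

lemma hasDerivAt_rpowExpSqrt (s : ℝ) {x : ℝ} (hx : 0 < x) :
    HasDerivAt (rpowExpSqrt s) (rpowExpSqrt (s - 1 / 2) x * (s * x ^ (-(1 / 2) : ℝ) - 1)) x := by
  have h := (Real.hasDerivAt_rpow_const (p := s) (Or.inl hx.ne')).mul
    ((Real.hasDerivAt_sqrt hx.ne').const_mul (-2)).exp
  refine h.congr_deriv ?_
  have h1 : x ^ (s - 1) = x ^ (s - 1 / 2) * x ^ (-(1 / 2) : ℝ) := by
    rw [← Real.rpow_add hx]; ring_nf
  have h2 : x ^ s = x ^ (s - 1 / 2) * Real.sqrt x := by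
    rw [Real.sqrt_eq_rpow, ← Real.rpow_add hx]; ring_nf
  have h3 : Real.sqrt x ≠ 0 := (Real.sqrt_pos.2 hx).ne'
  rw [h1, h2, rpowExpSqrt]
  field_simp
  ring

lemma continuousOn_rpowExpSqrt (s : ℝ) : ContinuousOn (rpowExpSqrt s) (Ioi 0) :=
  fun _ hx => (hasDerivAt_rpowExpSqrt s hx).continuousAt.continuousWithinAt

lemma integrableOn_rpowExpSqrt (s : ℝ) {x : ℝ} (hx : 0 < x) :
    IntegrableOn (rpowExpSqrt s) (Ioi x) := by
  have hc : ContinuousOn (rpowExpSqrt s) (Ici x) :=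
    (continuousOn_rpowExpSqrt s).mono fun _ hy => hx.trans_le hy
  refine ((hc.locallyIntegrableOn measurableSet_Ici).integrableOn_of_isBigO_atTop
    (g := fun t : ℝ => t ^ (-2 : ℝ)) ?_
    ⟨Ioi 1, Ioi_mem_atTop 1, integrableOn_Ioi_rpow_of_lt (by norm_num) one_pos⟩).mono_set
      Ioi_subset_Ici_self
  have h := ((tendsto_rpowExpSqrt (2 + s)).isBigO_one ℝ).mul
    (Asymptotics.isBigO_refl (fun t : ℝ => t ^ (-2 : ℝ)) atTop)
  refine h.congr' ?_ (by simp)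
  filter_upwards [eventually_gt_atTop 0] with t ht
  rw [mul_comm, rpow_mul_rpowExpSqrt _ _ ht]
  ring_nf

lemma hasDerivAt_integral_Ioi_rpowExpSqrt (s : ℝ) {x : ℝ} (hx : 0 < x) :
    HasDerivAt (fun x => ∫ t in Ioi x, rpowExpSqrt s t) (-rpowExpSqrt s x) x := by
  have hi : IntervalIntegrable (rpowExpSqrt s) volume 1 x :=
    ((continuousOn_rpowExpSqrt s).mono fun y hy =>
      (lt_min one_pos hx).trans_le hy.1).intervalIntegrable
  have h := (intervalIntegral.integral_hasDerivAt_right hi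
    ((continuousOn_rpowExpSqrt s).stronglyMeasurableAtFilter isOpen_Ioi x hx)
    (hasDerivAt_rpowExpSqrt s hx).continuousAt).const_sub (∫ t in Ioi 1, rpowExpSqrt s t)
  refine h.congr_of_eventuallyEq ?_
  filter_upwards [eventually_gt_nhds hx] with y hy
  rw [← intervalIntegral.integral_interval_add_Ioi (integrableOn_rpowExpSqrt s one_pos)
    (integrableOn_rpowExpSqrt s hy)]
  simp

/-- L'Hôpital's rule against the profile `x ^ s * e ^ (-2 √x)`. -/
lemma tendsto_div_rpowExpSqrt_of_hasDerivAt {f f' : ℝ → ℝ} (s : ℝ)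
    (hf : ∀ x, 0 < x → HasDerivAt f (-f' x) x) (hf0 : Tendsto f atTop (𝓝 0))
    (hf' : Tendsto (fun x => f' x / rpowExpSqrt (s - 1 / 2) x) atTop (𝓝 1)) :
    Tendsto (fun x => f x / rpowExpSqrt s x) atTop (𝓝 1) := by
  have hlim : Tendsto (fun x : ℝ => s * x ^ (-(1 / 2) : ℝ) - 1) atTop (𝓝 (-1)) := by
    simpa using ((tendsto_rpow_neg_atTop (y := 1 / 2) (by norm_num)).const_mul s).sub_const 1
  refine HasDerivAt.lhopital_zero_atTop
    ((eventually_gt_atTop 0).mono hf)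
    ((eventually_gt_atTop 0).mono fun x hx => hasDerivAt_rpowExpSqrt s hx)
    ?_ hf0 (tendsto_rpowExpSqrt s) ?_
  · filter_upwards [eventually_gt_atTop 0, hlim.eventually_ne (by norm_num : (-1 : ℝ) ≠ 0)]
      with x hx h
    exact mul_ne_zero (rpowExpSqrt_pos _ hx).ne' h
  · have h := hf'.neg.div hlim (by norm_num)
    rw [div_self (by norm_num)] at h
    refine h.congr fun x => ?_
    simp only [Pi.div_apply]
    rw [← neg_div, div_div]

lemma tendsto_integral_Ioi_div_rpowExpSqrt (s : ℝ) :
    Tendsto (fun x => (∫ t in Ioi x, rpowExpSqrt s t) / rpowExpSqrt (s + 1 / 2) x)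
      atTop (𝓝 1) := by
  refine tendsto_div_rpowExpSqrt_of_hasDerivAt _
    (fun x hx => hasDerivAt_integral_Ioi_rpowExpSqrt s hx) (tendsto_integral_Ioi_zero tendsto_id) ?_
  refine tendsto_const_nhds.congr' ?_
  filter_upwards [eventually_gt_atTop 0] with x hx
  rw [add_sub_cancel_right, div_self (rpowExpSqrt_pos s hx).ne']

lemma tendsto_mul_integral_Ioi_rpowExpSqrt (s : ℝ) :
    Tendsto (fun x => x * ∫ t in Ioi x, rpowExpSqrt s t) atTop (𝓝 0) := by
  have h := (tendsto_integral_Ioi_div_rpowExpSqrt s).mul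
    (tendsto_rpowExpSqrt (1 + (s + 1 / 2)))
  rw [mul_zero] at h
  refine h.congr' ?_
  filter_upwards [eventually_gt_atTop 0] with x hx
  rw [← mul_rpowExpSqrt _ hx]
  rw [mul_left_comm, div_mul_cancel₀ _ (rpowExpSqrt_pos (s + 1 / 2) hx).ne']

lemma integral_Ioi_sub_mul_rpowExpSqrt (a : ℝ) {x : ℝ} (hx : 0 < x) :
    ∫ t in Ioi x, (1 / x - 1 / t) * t ^ a * Real.exp (-2 * Real.sqrt t) =
      ((∫ t in Ioi x, rpowExpSqrt a t) - x * ∫ t in Ioi x, rpowExpSqrt (a - 1) t) / x := by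
  have h : ∫ t in Ioi x, (1 / x - 1 / t) * t ^ a * Real.exp (-2 * Real.sqrt t) =
      ∫ t in Ioi x, (x⁻¹ * rpowExpSqrt a t - rpowExpSqrt (a - 1) t) := by
    refine setIntegral_congr_fun measurableSet_Ioi fun t ht => ?_
    have ht0 : 0 < t := hx.trans ht
    simp only [rpowExpSqrt, Real.rpow_sub_one ht0.ne']
    ring
  rw [h, integral_sub ((integrableOn_rpowExpSqrt a hx).const_mul _)
    (integrableOn_rpowExpSqrt (a - 1) hx), integral_const_mul]
  field_simp

/-- Large-cutoff asymptotic of the power-constraint integral (eqs. (17)–(20) of the paper):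
`∫_x^∞ (1/x − 1/λ) λ^a e^{−2√λ} dλ ~ x^{a−1} e^{−2√x}` as `x → ∞`. -/
theorem power_constraint_integral_asymptotic (a : ℝ) :
    Tendsto (fun x : ℝ =>
        (∫ lam in Ioi x, (1 / x - 1 / lam) * lam ^ a * Real.exp (-2 * Real.sqrt lam)) /
          (x ^ (a - 1) * Real.exp (-2 * Real.sqrt x)))
      atTop (𝓝 1) := by
  have hderiv : ∀ x : ℝ, 0 < x → HasDerivAt
      (fun x => (∫ t in Ioi x, rpowExpSqrt a t) - x * ∫ t in Ioi x, rpowExpSqrt (a - 1) t)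
      (-∫ t in Ioi x, rpowExpSqrt (a - 1) t) x := fun x hx => by
    refine ((hasDerivAt_integral_Ioi_rpowExpSqrt a hx).sub
      ((hasDerivAt_id x).mul (hasDerivAt_integral_Ioi_rpowExpSqrt (a - 1) hx))).congr_deriv ?_
    have := mul_rpowExpSqrt (a - 1) hx
    rw [add_sub_cancel] at this
    simp only [id_eq]
    linarith
  have hzero := (tendsto_integral_Ioi_zero (μ := volume) (f := rpowExpSqrt a) tendsto_id).sub
    (tendsto_mul_integral_Ioi_rpowExpSqrt (a - 1))
  rw [sub_zero] at hzero
  have hquot := tendsto_integral_Ioi_div_rpowExpSqrt (a - 1)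
  rw [show a - 1 + 1 / 2 = a - 1 / 2 by ring] at hquot
  refine (tendsto_div_rpowExpSqrt_of_hasDerivAt a hderiv hzero hquot).congr' ?_
  filter_upwards [eventually_gt_atTop 0] with x hx
  have h := mul_rpowExpSqrt (a - 1) hx
  rw [add_sub_cancel] at h
  rw [integral_Ioi_sub_mul_rpowExpSqrt a hx, div_div, ← h, rpowExpSqrt]
end

section
/- Let c ∈ ℝ and K > 0. Suppose x : (0,∞) → (0,∞) satisfies x(s) → ∞ as s → 0+ and K · x(s)^c · e^{−2√(x(s))} = s for all sufficiently small s > 0. Then x(s) / ( (1/4) log²(1/s) ) → 1 as s → 0+. -/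
open MeasureTheory Filter Set Topology

/-- Constants and multiples of `log y` are negligible against `2√y`. -/
theorem tendsto_two_mul_sqrt_sub_log_div (c k : ℝ) :
    Tendsto (fun y : ℝ => (2 * √y - k - c * Real.log y) / (2 * √y)) atTop (𝓝 1) := by
  have hlog : Tendsto (fun y : ℝ => Real.log y / √y) atTop (𝓝 0) := by
    simpa only [← Real.sqrt_eq_rpow] using
      (isLittleO_log_rpow_atTop (by norm_num : (0 : ℝ) < 1 / 2)).tendsto_div_nhds_zero
  have hconst : Tendsto (fun y : ℝ => k / √y) atTop (𝓝 0) :=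
    Real.tendsto_sqrt_atTop.const_div_atTop k
  have hlim : Tendsto (fun y : ℝ => 1 - 1 / 2 * (k / √y) - c / 2 * (Real.log y / √y))
      atTop (𝓝 1) := by
    simpa only [mul_zero, sub_zero] using
      ((tendsto_const_nhds (x := (1 : ℝ))).sub (hconst.const_mul (1 / 2))).sub
        (hlog.const_mul (c / 2))
  refine hlim.congr' ?_
  filter_upwards [eventually_gt_atTop 0] with y hy
  have hsqrt : √y ≠ 0 := (Real.sqrt_pos.2 hy).ne'
  field_simp

/-- Inversion step (eq. (24) of the paper): if the cutoff `x(s)` satisfies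
`K x(s)^c e^{−2√x(s)} = s` for small `s` and `x(s) → ∞` as `s → 0⁺`, then
`x(s) ~ (1/4) log²(1/s)` as `s → 0⁺`. -/
theorem cutoff_inversion (c K : ℝ) (hK : 0 < K)
    (x : ℝ → ℝ) (hxpos : ∀ s > (0 : ℝ), 0 < x s)
    (hx_top : Tendsto x (𝓝[>] (0 : ℝ)) atTop)
    (heq : ∀ᶠ s in 𝓝[>] (0 : ℝ),
      K * x s ^ c * Real.exp (-2 * Real.sqrt (x s)) = s) :
    Tendsto (fun s => x s / (1 / 4 * Real.log (1 / s) ^ 2))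
      (𝓝[>] (0 : ℝ)) (𝓝 1) := by
  have hlim := ((tendsto_two_mul_sqrt_sub_log_div c (Real.log K)).comp hx_top).pow 2 |>.inv₀
    (by norm_num)
  simp only [one_pow, inv_one] at hlim
  refine hlim.congr' ?_
  filter_upwards [heq, self_mem_nhdsWithin] with s hs hs0
  have hx : 0 < x s := hxpos s hs0
  have hlog : Real.log (1 / s) = 2 * √(x s) - Real.log K - c * Real.log (x s) := by
    have hxc : x s ^ c ≠ 0 := (Real.rpow_pos_of_pos hx c).ne'
    have h := congrArg Real.log hs
    rw [Real.log_mul (mul_ne_zero hK.ne' hxc) (Real.exp_ne_zero _), Real.log_mul hK.ne' hxc,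
      Real.log_rpow hx, Real.log_exp] at h
    rw [one_div, Real.log_inv]
    linarith
  rw [Function.comp_apply, ← hlog, div_pow, mul_pow, Real.sq_sqrt hx.le, inv_div]
  field_simp
  ring
end

section
/- Let m_1, m_2 > 0 and let f(λ) = ∫_0^∞ g_{m_1,1}(z) · g_{m_2,1}(λ/z) · z^{-1} dz for λ > 0. Suppose x : (0,∞) → (0,∞) satisfies ∫_{x(s)}^∞ (1/x(s) − 1/λ) f(λ) dλ = s for every s > 0, and define C(s) = ∫_{x(s)}^∞ log(λ/x(s)) f(λ) dλ. Then C(s) / ( x(s) · s ) → 1 as s → 0+. -/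
open MeasureTheory Filter Set Topology

open Real in
theorem integrableOn_rpow_mul_exp_neg_add_div (p : ℝ) {a r : ℝ} (ha : 0 < a) (hr : 0 < r) :
    IntegrableOn (fun z : ℝ => z ^ p * exp (-(r * (z + a / z)))) (Ioi 0) := by
  obtain ⟨n, hn⟩ := exists_nat_gt (-p)
  have hb : 0 < r * a := mul_pos hr ha
  have hint : IntegrableOn (fun z : ℝ => n.factorial / (r * a) ^ n *
      (z ^ (p + n) * exp (-r * z ^ (1 : ℝ)))) (Ioi 0) :=
    (integrableOn_rpow_mul_exp_neg_mul_rpow (by linarith) one_pos hr).const_mul _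
  refine hint.mono' (by fun_prop) ?_
  filter_upwards [ae_restrict_mem measurableSet_Ioi] with z (hz : 0 < z)
  have hy : 0 < r * a / z := by positivity
  have h1 : (r * a / z) ^ n / n.factorial ≤ exp (r * a / z) := pow_div_factorial_le_exp _ hy.le n
  have h2 : exp (-(r * a / z)) ≤ n.factorial / (r * a) ^ n * z ^ n := by
    rw [exp_neg]
    refine (inv_anti₀ (by positivity) h1).trans (le_of_eq ?_)
    rw [div_pow]
    field_simp
  have h3 : exp (-(r * (z + a / z))) = exp (-r * z) * exp (-(r * a / z)) := by
    rw [← exp_add]; congr 1; ring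
  rw [norm_of_nonneg (by positivity), h3, rpow_one, rpow_add hz, rpow_natCast]
  calc z ^ p * (exp (-r * z) * exp (-(r * a / z)))
      ≤ z ^ p * (exp (-r * z) * (n.factorial / (r * a) ^ n * z ^ n)) := by gcongr
    _ = _ := by ring

open Real in
theorem integral_rpow_mul_exp_neg_add_div_pos (p : ℝ) {a : ℝ} (ha : 0 < a) :
    0 < ∫ z in Ioi (0 : ℝ), z ^ p * exp (-(z + a / z)) := by
  have hint := integrableOn_rpow_mul_exp_neg_add_div p ha one_pos
  simp only [one_mul] at hint
  refine (setIntegral_pos_iff_support_of_nonneg_ae ?_ hint).2 ?_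
  · filter_upwards [ae_restrict_mem measurableSet_Ioi] with z (hz : 0 < z)
    simp only [Pi.zero_apply]
    positivity
  · have : Ioi (0 : ℝ) ⊆ (Function.support fun z : ℝ => z ^ p * exp (-(z + a / z))) ∩ Ioi 0 :=
      fun z (hz : 0 < z) => ⟨by simp only [Function.mem_support]; positivity, hz⟩
    exact lt_of_lt_of_le (by simp) (measure_mono this)

open Real in
theorem integral_rpow_mul_exp_neg_add_div_sq_mul_le (p : ℝ) {a r : ℝ} (ha : 0 < a) (hr : 1 ≤ r) :
    ∫ z in Ioi (0 : ℝ), z ^ p * exp (-(z + r ^ 2 * a / z)) ≤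
      r ^ (p + 1) * exp (-(2 * (r - 1) * √a)) *
        ∫ z in Ioi (0 : ℝ), z ^ p * exp (-(z + a / z)) := by
  have hr0 : 0 < r := by linarith
  have hcov := integral_comp_mul_left_Ioi
    (fun z : ℝ => z ^ p * exp (-(z + r ^ 2 * a / z))) 0 hr0
  rw [mul_zero, smul_eq_mul] at hcov
  have hscale : ∫ z in Ioi (0 : ℝ), z ^ p * exp (-(z + r ^ 2 * a / z)) =
      r ^ (p + 1) * ∫ z in Ioi (0 : ℝ), z ^ p * exp (-(r * (z + a / z))) := by
    rw [← integral_const_mul, ← mul_inv_cancel_left₀ hr0.ne'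
      (∫ z in Ioi (0 : ℝ), z ^ p * exp (-(z + r ^ 2 * a / z))), ← hcov, ← integral_const_mul]
    refine setIntegral_congr_fun measurableSet_Ioi fun z (hz : 0 < z) => ?_
    rw [mul_rpow hr0.le hz.le, rpow_add_one hr0.ne',
      show r * z + r ^ 2 * a / (r * z) = r * (z + a / z) by field_simp]
    ring
  rw [hscale, mul_assoc]
  refine mul_le_mul_of_nonneg_left ?_ (rpow_nonneg hr0.le _)
  rw [← integral_const_mul]
  have hint := integrableOn_rpow_mul_exp_neg_add_div p ha one_pos
  simp only [one_mul] at hint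
  refine setIntegral_mono_on (integrableOn_rpow_mul_exp_neg_add_div p ha hr0)
    (hint.const_mul _) measurableSet_Ioi fun z (hz : 0 < z) => ?_
  have hamgm : 2 * √a ≤ z + a / z := by
    rw [← sub_nonneg]
    have : z + a / z - 2 * √a = (z - √a) ^ 2 / z := by
      field_simp
      linear_combination -Real.sq_sqrt ha.le
    rw [this]
    positivity
  rw [mul_left_comm, ← exp_add]
  gcongr
  nlinarith

open Real in
theorem integral_gammaDen_mul_gammaDen_div (m₁ m₂ : ℝ) {a : ℝ} (ha : 0 < a) :
    ∫ z in Ioi (0 : ℝ), gammaDen m₁ 1 z * gammaDen m₂ 1 (a / z) * z⁻¹ =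
      (Gamma m₁ * Gamma m₂)⁻¹ * a ^ (m₂ - 1) *
        ∫ z in Ioi (0 : ℝ), z ^ (m₁ - m₂ - 1) * exp (-(z + a / z)) := by
  rw [← integral_const_mul]
  refine setIntegral_congr_fun measurableSet_Ioi fun z (hz : 0 < z) => ?_
  have hp : z ^ (m₁ - m₂ - 1) = z ^ (m₁ - 1) / z ^ (m₂ - 1) * z⁻¹ := by
    rw [← rpow_sub hz, ← rpow_neg_one, ← rpow_add hz]; congr 1; ring
  simp only [gammaDen, if_pos hz, if_pos (div_pos ha hz), div_one, one_rpow, mul_one]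
  rw [div_rpow ha.le hz.le, neg_add, exp_add, hp]
  simp only [div_eq_mul_inv, mul_inv]
  ring

open Real in
theorem antitoneOn_rpow_mul_integral_gammaDen {m₁ m₂ N : ℝ} (hm₁ : 0 < m₁) (hm₂ : 0 < m₂)
    {f : ℝ → ℝ}
    (hf : ∀ a > (0 : ℝ), f a =
      ∫ z in Ioi (0 : ℝ), gammaDen m₁ 1 z * gammaDen m₂ 1 (a / z) * z⁻¹) :
    ∃ L > 0, AntitoneOn (fun a => a ^ N * f a) (Ici L) := by
  set Q := m₁ + m₂ - 2 + 2 * N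
  refine ⟨Q ^ 2 + 1, by positivity, fun a ha b hb hab => ?_⟩
  have ha0 : 0 < a := lt_of_lt_of_le (by positivity) (mem_Ici.1 ha)
  have hb0 : 0 < b := ha0.trans_le hab
  obtain ⟨r, hr, rfl⟩ : ∃ r, 1 ≤ r ∧ b = r ^ 2 * a :=
    ⟨√(b / a), one_le_sqrt.2 ((one_le_div ha0).2 hab), by
      rw [sq_sqrt (by positivity)]; field_simp⟩
  have hr0 : 0 < r := by linarith
  have hQ : Q ≤ √a := le_sqrt_of_sq_le (by linarith [mem_Ici.1 ha])
  have hI := integral_rpow_mul_exp_neg_add_div_sq_mul_le (m₁ - m₂ - 1) ha0 hr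
  have hIpos := integral_rpow_mul_exp_neg_add_div_pos (m₁ - m₂ - 1) ha0
  simp only
  rw [hf _ ha0, hf _ hb0, integral_gammaDen_mul_gammaDen_div _ _ ha0,
    integral_gammaDen_mul_gammaDen_div _ _ hb0]
  set I := ∫ z in Ioi (0 : ℝ), z ^ (m₁ - m₂ - 1) * exp (-(z + a / z))
  have hG : 0 < (Gamma m₁ * Gamma m₂)⁻¹ :=
    inv_pos.2 (mul_pos (Gamma_pos_of_pos hm₁) (Gamma_pos_of_pos hm₂))
  have hpow : (r ^ 2) ^ N * (r ^ 2) ^ (m₂ - 1) * r ^ (m₁ - m₂ - 1 + 1) = r ^ Q := by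
    rw [← rpow_natCast r 2, ← rpow_mul hr0.le, ← rpow_mul hr0.le, ← rpow_add hr0, ← rpow_add hr0]
    congr 1
    push_cast
    simp only [Q]
    ring
  have hdecay : r ^ Q * exp (-(2 * (r - 1) * √a)) ≤ 1 := by
    rw [rpow_def_of_pos hr0, ← exp_add, exp_le_one_iff]
    have hlog : log r ≤ r - 1 := log_le_sub_one_of_pos hr0
    have hlog0 : 0 ≤ log r := log_nonneg hr
    nlinarith [mul_le_mul_of_nonneg_left hQ hlog0, mul_le_mul_of_nonneg_right hlog (sqrt_nonneg a),
      mul_nonneg (sub_nonneg.2 hr) (sqrt_nonneg a)]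
  rw [mul_rpow (by positivity) ha0.le, mul_rpow (by positivity) ha0.le]
  calc (r ^ 2) ^ N * a ^ N * ((Gamma m₁ * Gamma m₂)⁻¹ * ((r ^ 2) ^ (m₂ - 1) * a ^ (m₂ - 1)) *
        ∫ z in Ioi (0 : ℝ), z ^ (m₁ - m₂ - 1) * exp (-(z + r ^ 2 * a / z)))
      ≤ (r ^ 2) ^ N * a ^ N * ((Gamma m₁ * Gamma m₂)⁻¹ * ((r ^ 2) ^ (m₂ - 1) * a ^ (m₂ - 1)) *
        (r ^ (m₁ - m₂ - 1 + 1) * exp (-(2 * (r - 1) * √a)) * I)) := by gcongr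
    _ = a ^ N * ((Gamma m₁ * Gamma m₂)⁻¹ * a ^ (m₂ - 1) * I) *
        (r ^ Q * exp (-(2 * (r - 1) * √a))) := by rw [← hpow]; ring
    _ ≤ a ^ N * ((Gamma m₁ * Gamma m₂)⁻¹ * a ^ (m₂ - 1) * I) :=
      mul_le_of_le_one_right (by positivity) hdecay

open Real in
theorem integrableOn_mul_of_antitoneOn_rpow_mul {f w : ℝ → ℝ} {a c N : ℝ} (ha : 0 < a)
    (hN : 2 < N) (hf : ∀ t > a, 0 ≤ f t) (hanti : AntitoneOn (fun t => t ^ N * f t) (Ici a))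
    (hw : Measurable w) (hw0 : ∀ t > a, 0 ≤ w t) (hwc : ∀ t > a, w t ≤ c * t) :
    IntegrableOn (fun t => w t * f t) (Ioi a) := by
  have hint : IntegrableOn (fun t => c * (a ^ N * f a) * t ^ (1 - N)) (Ioi a) :=
    (integrableOn_Ioi_rpow_of_lt (by linarith) ha).const_mul _
  have hmeas : AEMeasurable (fun t => t ^ N * f t) (volume.restrict (Ioi a)) :=
    aemeasurable_restrict_of_antitoneOn measurableSet_Ioi (hanti.mono Ioi_subset_Ici_self)
  have heq : ∀ t > a, f t = t ^ (-N) * (t ^ N * f t) := fun t ht => by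
    rw [← mul_assoc, ← rpow_add (ha.trans ht), neg_add_cancel, rpow_zero, one_mul]
  have hfm : AEMeasurable f (volume.restrict (Ioi a)) := by
    refine ((by fun_prop : Measurable fun t : ℝ => t ^ (-N)).aemeasurable.mul hmeas).congr ?_
    filter_upwards [ae_restrict_mem measurableSet_Ioi] with t ht using (heq t ht).symm
  refine hint.mono' (hw.aemeasurable.mul hfm).aestronglyMeasurable ?_
  filter_upwards [ae_restrict_mem measurableSet_Ioi] with t (ht : a < t)
  have ht0 : 0 < t := ha.trans ht
  have hk : t ^ N * f t ≤ a ^ N * f a := hanti (mem_Ici.2 le_rfl) (mem_Ici.2 ht.le) ht.le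
  have hct : 0 ≤ c * t := (hw0 t ht).trans (hwc t ht)
  rw [norm_of_nonneg (mul_nonneg (hw0 t ht) (hf t ht))]
  calc w t * f t ≤ c * t * f t := mul_le_mul_of_nonneg_right (hwc t ht) (hf t ht)
    _ = c * t * (t ^ (-N) * (t ^ N * f t)) := by rw [← heq t ht]
    _ ≤ c * t * (t ^ (-N) * (a ^ N * f a)) := by gcongr
    _ = c * (a ^ N * f a) * t ^ (1 - N) := by
      rw [sub_eq_add_neg, rpow_add ht0, rpow_one]; ring

theorem integrableOn_inv_sub_inv_mul {f : ℝ → ℝ} {a N : ℝ} (ha : 0 < a)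
    (hN : 2 < N) (hf : ∀ t > a, 0 ≤ f t) (hanti : AntitoneOn (fun t => t ^ N * f t) (Ici a)) :
    IntegrableOn (fun t => (1 / a - 1 / t) * f t) (Ioi a) := by
  refine integrableOn_mul_of_antitoneOn_rpow_mul (c := 1 / a ^ 2) ha hN hf hanti
    (by fun_prop) (fun t ht => sub_nonneg.2 (one_div_le_one_div_of_le ha ht.le)) fun t ht => ?_
  have ht0 : 0 < t := ha.trans ht
  have h1 : 1 / a ≤ 1 / a ^ 2 * t := by
    rw [div_mul_eq_mul_div, div_le_div_iff₀ ha (by positivity)]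
    nlinarith
  linarith [one_div_pos.2 ht0]

open Real in
theorem integrableOn_log_div_mul {f : ℝ → ℝ} {a N : ℝ} (ha : 0 < a)
    (hN : 2 < N) (hf : ∀ t > a, 0 ≤ f t) (hanti : AntitoneOn (fun t => t ^ N * f t) (Ici a)) :
    IntegrableOn (fun t => log (t / a) * f t) (Ioi a) := by
  refine integrableOn_mul_of_antitoneOn_rpow_mul (c := 1 / a) ha hN hf hanti
    (by fun_prop) (fun t ht => log_nonneg ((one_le_div ha).2 ht.le)) fun t ht => ?_
  have := log_le_self (div_pos (ha.trans ht) ha).le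
  linarith [show 1 / a * t = t / a by ring]

open Real in
theorem mul_integral_inv_sub_inv_le_integral_log {f : ℝ → ℝ} {a N : ℝ} (ha : 0 < a)
    (hN : 2 < N) (hf : ∀ t > a, 0 ≤ f t) (hanti : AntitoneOn (fun t => t ^ N * f t) (Ici a)) :
    a * ∫ t in Ioi a, (1 / a - 1 / t) * f t ≤ ∫ t in Ioi a, log (t / a) * f t := by
  rw [← integral_const_mul]
  refine setIntegral_mono_on ((integrableOn_inv_sub_inv_mul ha hN hf hanti).const_mul _)
    (integrableOn_log_div_mul ha hN hf hanti) measurableSet_Ioi fun t (ht : a < t) => ?_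
  have ht0 : 0 < t := ha.trans ht
  rw [← mul_assoc]
  refine mul_le_mul_of_nonneg_right ?_ (hf t ht)
  have := one_sub_inv_le_log_of_pos (div_pos ht0 ha)
  rwa [inv_div, show 1 - a / t = a * (1 / a - 1 / t) by field_simp] at this

open Real in
theorem integrableOn_and_integral_quadratic_mul_rpow {a N : ℝ} (ha : 0 < a) (hN : 2 < N) :
    IntegrableOn (fun t => (t - (1 + 2 / (N - 2)) * a) * (t - a) * t ^ (-N - 1)) (Ioi a) ∧
      ∫ t in Ioi a, (t - (1 + 2 / (N - 2)) * a) * (t - a) * t ^ (-N - 1) = 0 := by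
  set e := 2 / (N - 2) with he
  have hcongr : EqOn (fun t => t ^ (1 - N) - (2 + e) * a * t ^ (-N) + (1 + e) * a ^ 2 * t ^ (-N - 1))
      (fun t => (t - (1 + e) * a) * (t - a) * t ^ (-N - 1)) (Ioi a) := fun t ht => by
    have ht0 : 0 < t := ha.trans ht
    simp only
    rw [show 1 - N = -N - 1 + 1 + 1 by ring, show -N = -N - 1 + 1 by ring]
    rw [show -N - 1 + 1 - 1 = -N - 1 by ring]
    rw [rpow_add_one ht0.ne', rpow_add_one ht0.ne']
    ring
  have h1 : IntegrableOn (fun t : ℝ => t ^ (1 - N)) (Ioi a) :=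
    integrableOn_Ioi_rpow_of_lt (by linarith) ha
  have h2 : IntegrableOn (fun t : ℝ => (2 + e) * a * t ^ (-N)) (Ioi a) :=
    (integrableOn_Ioi_rpow_of_lt (by linarith) ha).const_mul _
  have h3 : IntegrableOn (fun t : ℝ => (1 + e) * a ^ 2 * t ^ (-N - 1)) (Ioi a) :=
    (integrableOn_Ioi_rpow_of_lt (by linarith) ha).const_mul _
  refine ⟨((h1.sub h2).add h3).congr_fun hcongr measurableSet_Ioi, ?_⟩
  rw [← setIntegral_congr_fun measurableSet_Ioi hcongr, integral_add (f := fun t => t ^ (1 - N) - (2 + e) * a * t ^ (-N)) (h1.sub h2) h3,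
    integral_sub h1 h2, integral_const_mul, integral_const_mul,
    integral_Ioi_rpow_of_lt (by linarith) ha, integral_Ioi_rpow_of_lt (by linarith) ha,
    integral_Ioi_rpow_of_lt (by linarith) ha,
    show 1 - N + 1 = -N + 1 + 1 by ring, show -N - 1 + 1 = -N by ring,
    rpow_add_one ha.ne', rpow_add_one ha.ne', he]
  have i1 : N - 2 ≠ 0 := by linarith
  have i2 : -N + 1 + 1 ≠ 0 := by linarith
  have i3 : -N + 1 ≠ 0 := by linarith
  have i4 : N ≠ 0 := by linarith
  field_simp
  ring

open Real in
theorem integral_log_le_mul_integral_inv_sub_inv {f : ℝ → ℝ} {a N : ℝ} (ha : 0 < a)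
    (hN : 2 < N) (hf : ∀ t > a, 0 ≤ f t) (hanti : AntitoneOn (fun t => t ^ N * f t) (Ici a)) :
    ∫ t in Ioi a, log (t / a) * f t ≤
      (1 + 2 / (N - 2)) * (a * ∫ t in Ioi a, (1 / a - 1 / t) * f t) := by
  obtain ⟨hqi, hq0⟩ := integrableOn_and_integral_quadratic_mul_rpow ha hN
  have he : 0 < 2 / (N - 2) := div_pos two_pos (by linarith)
  set e := 2 / (N - 2)
  set b := (1 + e) * a with hb
  have hab : a ≤ b := by nlinarith
  have hG := (integrableOn_inv_sub_inv_mul ha hN hf hanti).const_mul ((1 + e) * a)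
  have hq := hqi.const_mul (a⁻¹ * (b ^ N * f b))
  rw [← mul_assoc, ← integral_const_mul, ← add_zero (∫ t in Ioi a, (1 + e) * a * _),
    ← mul_zero (a⁻¹ * (b ^ N * f b)), ← hq0, ← integral_const_mul, ← integral_add hG hq]
  refine setIntegral_mono_on (integrableOn_log_div_mul ha hN hf hanti) (hG.add hq)
    measurableSet_Ioi fun t (ht : a < t) => ?_
  have ht0 : 0 < t := ha.trans ht
  have hlog : log (t / a) ≤ t / a - 1 := log_le_sub_one_of_pos (div_pos ht0 ha)
  have hsign : (t - b) * (t ^ N * f t) ≤ (t - b) * (b ^ N * f b) := by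
    rcases le_total t b with h | h
    · exact mul_le_mul_of_nonpos_left
        (hanti (mem_Ici.2 ht.le) (mem_Ici.2 hab) h) (sub_nonpos.2 h)
    · exact mul_le_mul_of_nonneg_left
        (hanti (mem_Ici.2 hab) (mem_Ici.2 ht.le) h) (sub_nonneg.2 h)
  have hweight : 0 ≤ a⁻¹ * (t - a) * t ^ (-N - 1) := by
    have := sub_nonneg.2 ht.le
    positivity
  have hcancel : t ^ (-N - 1) * t ^ N = t⁻¹ := by
    rw [← rpow_add ht0, ← rpow_neg_one]; congr 1; ring
  calc log (t / a) * f t ≤ (t / a - 1) * f t := mul_le_mul_of_nonneg_right hlog (hf t ht)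
    _ = b * ((1 / a - 1 / t) * f t) + a⁻¹ * (t - a) * ((t - b) * f t) * t⁻¹ := by
      field_simp
      ring
    _ = b * ((1 / a - 1 / t) * f t) +
        a⁻¹ * (t - a) * t ^ (-N - 1) * ((t - b) * (t ^ N * f t)) := by
      rw [← hcancel]; ring
    _ ≤ b * ((1 / a - 1 / t) * f t) +
        a⁻¹ * (t - a) * t ^ (-N - 1) * ((t - b) * (b ^ N * f b)) := by gcongr
    _ = _ := by ring

theorem integral_inv_sub_inv_pos {f : ℝ → ℝ} {a N : ℝ} (ha : 0 < a)
    (hN : 2 < N) (hf : ∀ t > a, 0 < f t) (hanti : AntitoneOn (fun t => t ^ N * f t) (Ici a)) :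
    0 < ∫ t in Ioi a, (1 / a - 1 / t) * f t := by
  have hpos : ∀ t > a, 0 < (1 / a - 1 / t) * f t := fun t ht =>
    mul_pos (sub_pos.2 (one_div_lt_one_div_of_lt ha ht)) (hf t ht)
  refine (setIntegral_pos_iff_support_of_nonneg_ae ?_
    (integrableOn_inv_sub_inv_mul ha hN (fun t ht => (hf t ht).le) hanti)).2 ?_
  · filter_upwards [ae_restrict_mem measurableSet_Ioi] with t ht using (hpos t ht).le
  · have : Ioi a ⊆ (Function.support fun t => (1 / a - 1 / t) * f t) ∩ Ioi a :=
      fun t ht => ⟨(hpos t ht).ne', ht⟩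
    exact lt_of_lt_of_le (by simp) (measure_mono this)

theorem integral_inv_sub_inv_le_of_le {f : ℝ → ℝ} {a b : ℝ} (ha : 0 < a) (hab : a ≤ b)
    (hf : ∀ t > a, 0 ≤ f t) (hint : IntegrableOn (fun t => (1 / a - 1 / t) * f t) (Ioi a)) :
    ∫ t in Ioi b, (1 / b - 1 / t) * f t ≤ ∫ t in Ioi a, (1 / a - 1 / t) * f t := by
  have hsub : Ioi b ⊆ Ioi a := Ioi_subset_Ioi hab
  calc ∫ t in Ioi b, (1 / b - 1 / t) * f t ≤ ∫ t in Ioi b, (1 / a - 1 / t) * f t := by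
        refine integral_mono_of_nonneg ?_ (hint.mono_set hsub) ?_
        · filter_upwards [ae_restrict_mem measurableSet_Ioi] with t (ht : b < t)
          exact mul_nonneg (sub_nonneg.2 (one_div_le_one_div_of_le (ha.trans_le hab) ht.le))
            (hf t (hsub ht))
        · filter_upwards [ae_restrict_mem measurableSet_Ioi] with t ht
          exact mul_le_mul_of_nonneg_right
            (sub_le_sub_right (one_div_le_one_div_of_le ha hab) _) (hf t (hsub ht))
    _ ≤ ∫ t in Ioi a, (1 / a - 1 / t) * f t := by
        refine setIntegral_mono_set hint ?_ hsub.eventuallyLE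
        filter_upwards [ae_restrict_mem measurableSet_Ioi] with t (ht : a < t)
        exact mul_nonneg (sub_nonneg.2 (one_div_le_one_div_of_le ha ht.le)) (hf t ht)

/-- Eq. (23) of the paper: at low SNR, the water-filling capacity of the double-Gamma
pinhole channel satisfies `C(s) ~ x(s) · s` where `x(s)` is the channel cutoff. -/
theorem lowSNR_capacity_eq_cutoff_mul_snr
    (m₁ m₂ : ℝ) (hm₁ : 0 < m₁) (hm₂ : 0 < m₂)
    (f : ℝ → ℝ)
    (hf : ∀ lam > (0 : ℝ), f lam =
      ∫ z in Ioi (0 : ℝ), gammaDen m₁ 1 z * gammaDen m₂ 1 (lam / z) * z⁻¹)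
    (x : ℝ → ℝ) (hxpos : ∀ s > (0 : ℝ), 0 < x s)
    (hpow : ∀ s > (0 : ℝ),
      (∫ lam in Ioi (x s), (1 / x s - 1 / lam) * f lam) = s)
    (C : ℝ → ℝ)
    (hC : ∀ s > (0 : ℝ), C s = ∫ lam in Ioi (x s), Real.log (lam / x s) * f lam) :
    Tendsto (fun s => C s / (x s * s)) (𝓝[>] (0 : ℝ)) (𝓝 1) := by
  have hfpos : ∀ t > (0 : ℝ), 0 < f t := fun t ht => by
    rw [hf t ht, integral_gammaDen_mul_gammaDen_div _ _ ht]
    have h₁ := Real.Gamma_pos_of_pos hm₁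
    have h₂ := Real.Gamma_pos_of_pos hm₂
    have hI := integral_rpow_mul_exp_neg_add_div_pos (m₁ - m₂ - 1) ht
    positivity
  have key : ∀ N > (2 : ℝ), ∀ᶠ s in 𝓝[>] (0 : ℝ),
      1 ≤ C s / (x s * s) ∧ C s / (x s * s) ≤ 1 + 2 / (N - 2) := by
    intro N hN
    obtain ⟨L, hL, hanti⟩ := antitoneOn_rpow_mul_integral_gammaDen (N := N) hm₁ hm₂ hf
    have hGL := integral_inv_sub_inv_pos hL hN (fun t ht => hfpos t (hL.trans ht)) hanti
    filter_upwards [Ioo_mem_nhdsGT hGL] with s ⟨(hs0 : 0 < s), hs⟩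
    have hx := hxpos s hs0
    have hLx : L ≤ x s := by
      by_contra! hlt
      have hint : IntegrableOn (fun t => (1 / x s - 1 / t) * f t) (Ioi (x s)) := by
        by_contra hni
        exact hs0.ne' ((hpow s hs0).symm.trans (integral_undef hni))
      have := integral_inv_sub_inv_le_of_le hx hlt.le
        (fun t ht => (hfpos t (hx.trans ht)).le) hint
      rw [hpow s hs0] at this
      linarith
    have hanti' := hanti.mono (Ici_subset_Ici.2 hLx)
    have hf0 : ∀ t > x s, 0 ≤ f t := fun t ht => (hfpos t (hx.trans ht)).le
    have hlower := mul_integral_inv_sub_inv_le_integral_log hx hN hf0 hanti'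
    have hupper := integral_log_le_mul_integral_inv_sub_inv hx hN hf0 hanti'
    rw [hpow s hs0, ← hC s hs0] at hlower hupper
    exact ⟨(one_le_div (by positivity)).2 hlower, (div_le_iff₀ (by positivity)).2 hupper⟩
  refine tendsto_order.2 ⟨fun c hc => ?_, fun c hc => ?_⟩
  · filter_upwards [key 3 (by norm_num)] with s hs using hc.trans_le hs.1
  · have hc0 : 0 < c - 1 := sub_pos.2 hc
    have hN : 2 < 2 + 4 / (c - 1) := by linarith [div_pos four_pos hc0]
    filter_upwards [key _ hN] with s hs
    refine hs.2.trans_lt ?_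
    rw [add_sub_cancel_left, show 2 / (4 / (c - 1)) = (c - 1) / 2 by field_simp; norm_num]
    linarith
end

section
/- Let m_T, m_R ≥ 1/2 and Ω_T, Ω_R > 0, and set b = Ω_T Ω_R/(m_T m_R). Let f be the density f(λ) = ∫_0^∞ g_{m_T,Ω_T/m_T}(z) · g_{m_R,Ω_R/m_R}(λ/z) · z^{-1} dz for λ > 0 of the product of two independent Gamma random variables with shapes m_T, m_R and scales Ω_T/m_T, Ω_R/m_R. Suppose x : (0,∞) → (0,∞) satisfies ∫_{x(s)}^∞ (1/x(s) − 1/λ) f(λ) dλ = s for every s > 0. Then x(s) / ( (b/4) · log²(1/s) ) → 1 as s → 0+. -/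
open MeasureTheory Filter Set Topology

lemma integrableOn_rpow_mul_exp_neg_sub_div (q : ℝ) {a c : ℝ} (ha : 0 < a) (hc : 0 < c) :
    IntegrableOn (fun z : ℝ => z ^ q * Real.exp (-(a * z) - c / z)) (Ioi 0) := by
  obtain ⟨N, hN⟩ := exists_nat_gt (-1 - q)
  have hdom : IntegrableOn
      (fun z : ℝ => (N.factorial / c ^ N) * (z ^ (q + N) * Real.exp (-a * z ^ (1 : ℝ))))
      (Ioi 0) :=
    (integrableOn_rpow_mul_exp_neg_mul_rpow (by linarith) one_pos ha).const_mul _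
  refine hdom.mono' ?_ ?_
  · refine ContinuousOn.aestronglyMeasurable ?_ measurableSet_Ioi
    refine ContinuousOn.mul ?_ ?_
    · exact fun z hz => (Real.continuousAt_rpow_const z q (Or.inl hz.ne')).continuousWithinAt
    · refine ContinuousOn.rexp (ContinuousOn.sub (by fun_prop) ?_)
      exact continuousOn_const.div continuousOn_id fun z hz => hz.ne'
  · refine (ae_restrict_iff' measurableSet_Ioi).2 (Eventually.of_forall fun z (hz : 0 < z) => ?_)
    have hpow := Real.pow_div_factorial_le_exp (c / z) (by positivity) N
    have hexp : Real.exp (-(c / z)) ≤ N.factorial / c ^ N * z ^ N := by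
      rw [Real.exp_neg]
      calc (Real.exp (c / z))⁻¹ ≤ ((c / z) ^ N / N.factorial)⁻¹ := by gcongr
        _ = N.factorial / c ^ N * z ^ N := by
          rw [div_pow]
          field_simp
    rw [Real.norm_of_nonneg (by positivity), sub_eq_add_neg, Real.exp_add, Real.rpow_one,
      Real.rpow_add hz, Real.rpow_natCast, neg_mul]
    calc z ^ q * (Real.exp (-(a * z)) * Real.exp (-(c / z)))
        ≤ z ^ q * (Real.exp (-(a * z)) * (N.factorial / c ^ N * z ^ N)) := by gcongr
      _ = _ := by ring

lemma two_mul_sqrt_mul_sqrt_le {a d lam z : ℝ} (ha : 0 < a) (hd : 0 < d) (hlam : 0 < lam)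
    (hz : 0 < z) : 2 * (√(a * d) * √lam) ≤ a * z + d * lam / z := by
  have h1 : √(a * d) * √lam = √(a * z) * √(d * lam / z) := by
    rw [← Real.sqrt_mul (by positivity), ← Real.sqrt_mul (by positivity)]
    congr 1
    field_simp
  have h2 := Real.sq_sqrt (show 0 ≤ a * z by positivity)
  have h3 := Real.sq_sqrt (show 0 ≤ d * lam / z by positivity)
  rw [h1]
  nlinarith [sq_nonneg (√(a * z) - √(d * lam / z))]

lemma eventually_const_mul_rpow_le_exp_sqrt (C p : ℝ) {δ : ℝ} (hδ : 0 < δ) :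
    ∀ᶠ t : ℝ in atTop, C * t ^ p < Real.exp (δ * √t) := by
  have h := ((tendsto_rpow_mul_exp_neg_mul_atTop_nhds_zero (2 * p) δ hδ).const_mul C).comp
    Real.tendsto_sqrt_atTop
  rw [mul_zero] at h
  filter_upwards [h.eventually_lt_const one_pos, eventually_gt_atTop 0] with t ht ht0
  have hp : √t ^ (2 * p) = t ^ p := by
    rw [Real.rpow_mul (Real.sqrt_nonneg t), Real.rpow_two, Real.sq_sqrt ht0.le]
  simp only [Function.comp_apply, hp, neg_mul, Real.exp_neg] at ht
  rw [← mul_assoc, ← div_eq_mul_inv, div_lt_one (Real.exp_pos _)] at ht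
  exact ht

lemma exists_integral_rpow_mul_exp_le (q : ℝ) {a d ε : ℝ} (ha : 0 < a) (hd : 0 < d)
    (hε : 0 < ε) (hε1 : ε < 1) :
    ∃ A : ℝ, ∀ lam ≥ (1 : ℝ),
      ∫ z in Ioi (0 : ℝ), z ^ q * Real.exp (-(a * z) - d * lam / z) ≤
        A * Real.exp (-((1 - ε) * (2 * √(a * d)) * √lam)) := by
  refine ⟨∫ z in Ioi (0 : ℝ), z ^ q * Real.exp (-(ε * a * z) - ε * d / z), fun lam hlam => ?_⟩
  have hlam0 : 0 < lam := by linarith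
  rw [← integral_mul_const]
  refine setIntegral_mono_on
    (integrableOn_rpow_mul_exp_neg_sub_div q ha (by positivity))
    ((integrableOn_rpow_mul_exp_neg_sub_div q (by positivity) (by positivity)).mul_const _)
    measurableSet_Ioi fun z (hz : 0 < z) => ?_
  rw [mul_assoc, ← Real.exp_add]
  gcongr
  have h1 := two_mul_sqrt_mul_sqrt_le ha hd hlam0 hz
  have h2 : d / z ≤ d * lam / z := by
    gcongr
    nlinarith
  have h3 := mul_le_mul_of_nonneg_left h1 (sub_pos.2 hε1).le
  have h4 := mul_le_mul_of_nonneg_left h2 hε.le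
  rw [mul_div_assoc ε d z]
  nlinarith

lemma eventually_le_integral_rpow_mul_exp (q : ℝ) {a d δ : ℝ} (ha : 0 < a) (hd : 0 < d)
    (hδ : 0 < δ) :
    ∀ᶠ lam : ℝ in atTop,
      Real.exp (-((2 * √(a * d) + δ) * √lam)) ≤
        ∫ z in Ioi (0 : ℝ), z ^ q * Real.exp (-(a * z) - d * lam / z) := by
  set k := √(d / a) with hk
  have hk0 : 0 < k := Real.sqrt_pos.2 (by positivity)
  set η := δ / (2 * k) with hη
  have hη0 : 0 < η := by positivity
  have hpoly : ∀ᶠ z : ℝ in atTop, z ^ (-q) * Real.exp (-η * z) < 1 :=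
    (tendsto_rpow_mul_exp_neg_mul_atTop_nhds_zero (-q) η hη0).eventually_lt_const one_pos
  obtain ⟨Z, hZ⟩ := eventually_atTop.1 hpoly
  have hs := Real.tendsto_sqrt_atTop
  filter_upwards [hs.eventually_ge_atTop (Z / k), hs.eventually_ge_atTop ((η + a) / (δ / 2)),
    eventually_gt_atTop 0] with lam h1 h2 hlam
  have hsl : 0 < √lam := Real.sqrt_pos.2 hlam
  rw [div_le_iff₀ hk0] at h1
  rw [div_le_iff₀ (by positivity)] at h2
  set z₀ := √lam * k with hz₀
  have hz₀0 : 0 < z₀ := by positivity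
  have hak : a * k = √(a * d) := by
    rw [hk, eq_comm, Real.sqrt_eq_iff_mul_self_eq_of_pos (by positivity)]
    have := Real.mul_self_sqrt (show 0 ≤ d / a by positivity)
    calc a * √(d / a) * (a * √(d / a)) = a * a * (√(d / a) * √(d / a)) := by ring
      _ = a * d := by rw [this]; field_simp
  have hdk : d / k = √(a * d) := by
    rw [← hak, div_eq_iff hk0.ne', mul_assoc, hk, Real.mul_self_sqrt (by positivity)]
    field_simp
  have hdz : d * lam / z₀ = √(a * d) * √lam := by
    rw [← hdk, hz₀]
    nth_rewrite 1 [← Real.mul_self_sqrt hlam.le]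
    field_simp
  have hint := integrableOn_rpow_mul_exp_neg_sub_div q ha (show 0 < d * lam by positivity)
  have hsub : Icc z₀ (z₀ + 1) ⊆ Ioi 0 := fun z hz => hz₀0.trans_le hz.1
  calc Real.exp (-((2 * √(a * d) + δ) * √lam))
      = ∫ z in Icc z₀ (z₀ + 1), Real.exp (-((2 * √(a * d) + δ) * √lam)) := by simp
    _ ≤ ∫ z in Icc z₀ (z₀ + 1), z ^ q * Real.exp (-(a * z) - d * lam / z) := by
      refine setIntegral_mono_on (by simp) (hint.mono_set hsub) measurableSet_Icc fun z hz => ?_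
      have hz0 : 0 < z := hsub hz
      have hzq : Real.exp (-η * z) ≤ z ^ q := by
        have := hZ z (by linarith [hz.1])
        rw [Real.rpow_neg hz0.le, inv_mul_lt_iff₀ (by positivity), mul_one] at this
        exact this.le
      have hdiv : d * lam / z ≤ √(a * d) * √lam := by
        rw [← hdz]
        gcongr
        exact hz.1
      calc Real.exp (-((2 * √(a * d) + δ) * √lam))
          ≤ Real.exp (-η * z + (-(a * z) - d * lam / z)) := by
            gcongr
            have hηk : η * z₀ = δ / 2 * √lam := by
              rw [hη, hz₀]
              field_simp
            have haz : a * z₀ = √(a * d) * √lam := by rw [← hak, hz₀]; ring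
            have h5 := mul_le_mul_of_nonneg_left hz.2 hη0.le
            have h6 := mul_le_mul_of_nonneg_left hz.2 ha.le
            nlinarith
        _ ≤ z ^ q * Real.exp (-(a * z) - d * lam / z) := by
            rw [Real.exp_add]
            gcongr
    _ ≤ _ := setIntegral_mono_set hint
      ((ae_restrict_iff' measurableSet_Ioi).2 (Eventually.of_forall fun z (hz : 0 < z) => by
        simp only [Pi.zero_apply]
        positivity)) hsub.eventuallyLE

lemma integral_gammaDen_mul_gammaDen_div_s16 {m n θ φ lam : ℝ} (hlam : 0 < lam) :
    ∫ z in Ioi (0 : ℝ), gammaDen m θ z * gammaDen n φ (lam / z) * z⁻¹ =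
      (Real.Gamma m * θ ^ m * (Real.Gamma n * φ ^ n))⁻¹ * lam ^ (n - 1) *
        ∫ z in Ioi (0 : ℝ), z ^ (m - n - 1) * Real.exp (-(θ⁻¹ * z) - φ⁻¹ * lam / z) := by
  rw [← integral_const_mul]
  refine setIntegral_congr_fun measurableSet_Ioi fun z (hz : 0 < z) => ?_
  have hq : z ^ (m - n - 1) = z ^ (m - 1) * (z ^ (n - 1))⁻¹ * z⁻¹ := by
    rw [← Real.rpow_neg hz.le, ← Real.rpow_neg_one z, ← Real.rpow_add hz, ← Real.rpow_add hz]
    congr 1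
    ring
  have he : Real.exp (-(θ⁻¹ * z) - φ⁻¹ * lam / z) =
      Real.exp (-z / θ) * Real.exp (-(lam / z) / φ) := by
    rw [← Real.exp_add]
    congr 1
    ring
  simp only [gammaDen, if_pos hz, if_pos (div_pos hlam hz)]
  rw [hq, he, Real.div_rpow hlam.le hz.le]
  simp only [div_eq_mul_inv, mul_inv]
  ring

lemma eventually_cutoff_integral_lt {f : ℝ → ℝ} {C p κ δ : ℝ}
    (hδ : 0 < δ) (hδκ : δ < κ) (hf0 : ∀ lam > (0 : ℝ), 0 ≤ f lam)
    (hf : ∀ᶠ lam : ℝ in atTop,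
      f lam ≤ C * lam ^ p * Real.exp (-((κ - δ / 2) * √lam))) :
    ∀ᶠ t : ℝ in atTop, IntegrableOn (fun lam => (1 / t - 1 / lam) * f lam) (Ioi t) →
      ∫ lam in Ioi t, (1 / t - 1 / lam) * f lam < Real.exp (-((κ - δ) * √t)) := by
  obtain ⟨T, hT⟩ := eventually_atTop.1
    (hf.and (eventually_const_mul_rpow_le_exp_sqrt C (p + 2) (half_pos hδ)))
  filter_upwards [eventually_ge_atTop T, eventually_gt_atTop 1] with t htT ht1 hint
  have ht0 : 0 < t := by linarith
  have hpt : ∀ lam ∈ Ioi t, (1 / t - 1 / lam) * f lam ≤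
      lam ^ (-2 : ℝ) * Real.exp (-((κ - δ) * √t)) := by
    intro lam (hl : t < lam)
    have hl0 : 0 < lam := ht0.trans hl
    obtain ⟨h1, h2⟩ := hT lam (by linarith)
    have hw : 1 / t - 1 / lam ≤ 1 := by
      have := (div_le_one ht0).2 ht1.le
      have : 0 < 1 / lam := by positivity
      linarith
    have hC : C * lam ^ p ≤ lam ^ (-2 : ℝ) * Real.exp (δ / 2 * √lam) := by
      rw [Real.rpow_neg hl0.le, ← div_eq_inv_mul, le_div_iff₀ (by positivity), mul_assoc,
        ← Real.rpow_add hl0]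
      exact h2.le
    calc (1 / t - 1 / lam) * f lam ≤ 1 * f lam := by
          gcongr
          exact hf0 lam hl0
      _ ≤ C * lam ^ p * Real.exp (-((κ - δ / 2) * √lam)) := by rw [one_mul]; exact h1
      _ ≤ lam ^ (-2 : ℝ) * Real.exp (δ / 2 * √lam) * Real.exp (-((κ - δ / 2) * √lam)) := by
          gcongr
      _ = lam ^ (-2 : ℝ) * Real.exp (-((κ - δ) * √lam)) := by
          rw [mul_assoc, ← Real.exp_add]
          congr 2
          ring
      _ ≤ _ := by
          have : 0 ≤ κ - δ := by linarith
          gcongr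
  have hint2 : IntegrableOn (fun lam : ℝ => lam ^ (-2 : ℝ)) (Ioi t) :=
    integrableOn_Ioi_rpow_of_lt (by norm_num) ht0
  calc ∫ lam in Ioi t, (1 / t - 1 / lam) * f lam
      ≤ ∫ lam in Ioi t, lam ^ (-2 : ℝ) * Real.exp (-((κ - δ) * √t)) :=
        setIntegral_mono_on hint (hint2.mul_const _) measurableSet_Ioi hpt
    _ = t⁻¹ * Real.exp (-((κ - δ) * √t)) := by
        rw [integral_mul_const, integral_Ioi_rpow_of_lt (by norm_num) ht0]
        norm_num [Real.rpow_neg_one]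
    _ < 1 * Real.exp (-((κ - δ) * √t)) := by
        gcongr
        exact inv_lt_one_of_one_lt₀ ht1
    _ = _ := one_mul _

lemma eventually_lt_cutoff_integral {f : ℝ → ℝ} {C p κ δ : ℝ}
    (hκ : 0 < κ) (hδ : 0 < δ) (hC : 0 < C) (hf0 : ∀ lam > (0 : ℝ), 0 ≤ f lam)
    (hf : ∀ᶠ lam : ℝ in atTop,
      C * lam ^ p * Real.exp (-((κ + δ / 3) * √lam)) ≤ f lam) :
    ∀ᶠ M : ℝ in atTop, ∀ t : ℝ, 0 < t → t ≤ M →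
      IntegrableOn (fun lam => (1 / t - 1 / lam) * f lam) (Ioi t) →
      Real.exp (-((κ + δ) * √M)) < ∫ lam in Ioi t, (1 / t - 1 / lam) * f lam := by
  have hδ3 : 0 < δ / 3 := by positivity
  obtain ⟨T, hT⟩ := eventually_atTop.1
    (hf.and (eventually_const_mul_rpow_le_exp_sqrt C⁻¹ (-p) hδ3))
  filter_upwards [eventually_ge_atTop T, eventually_gt_atTop 1,
    eventually_const_mul_rpow_le_exp_sqrt (2 * Real.exp ((κ + 2 * (δ / 3)) * 2)) 2 hδ3]
    with M hMT hM1 hM t ht htM hint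
  have hM0 : 0 < M := by linarith
  have hpt : ∀ lam ∈ Icc (M + 1) (M + 2),
      (M * (M + 1))⁻¹ * Real.exp (-((κ + 2 * (δ / 3)) * (√M + 2))) ≤
        (1 / t - 1 / lam) * f lam := by
    intro lam hl
    have hl0 : 0 < lam := by linarith [hl.1]
    obtain ⟨h1, h2⟩ := hT lam (by linarith [hl.1])
    have hw : (M * (M + 1))⁻¹ ≤ 1 / t - 1 / lam := by
      have h3 : 1 / M ≤ 1 / t := by gcongr
      have h4 : 1 / lam ≤ 1 / (M + 1) := by
        gcongr
        exact hl.1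
      have h5 : (M * (M + 1))⁻¹ = 1 / M - 1 / (M + 1) := by
        field_simp
        ring
      linarith
    have hsq : √lam ≤ √M + 2 := by
      rw [Real.sqrt_le_left (by positivity)]
      nlinarith [Real.sq_sqrt hM0.le, Real.sqrt_nonneg M, hl.2]
    have hC2 : Real.exp (-(δ / 3 * √lam)) ≤ C * lam ^ p := by
      rw [Real.exp_neg]
      rw [Real.rpow_neg hl0.le, ← mul_inv] at h2
      exact inv_le_of_inv_le₀ (by positivity) h2.le
    have hflow : Real.exp (-((κ + 2 * (δ / 3)) * (√M + 2))) ≤ f lam := by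
      calc Real.exp (-((κ + 2 * (δ / 3)) * (√M + 2)))
          ≤ Real.exp (-((κ + 2 * (δ / 3)) * √lam)) := by gcongr
        _ = Real.exp (-(δ / 3 * √lam)) * Real.exp (-((κ + δ / 3) * √lam)) := by
          rw [← Real.exp_add]
          congr 1
          ring
        _ ≤ C * lam ^ p * Real.exp (-((κ + δ / 3) * √lam)) := by gcongr
        _ ≤ f lam := h1
    have hinv : 0 < (M * (M + 1))⁻¹ := by positivity
    exact mul_le_mul hw hflow (Real.exp_pos _).le (hinv.le.trans hw)
  have hsub : Icc (M + 1) (M + 2) ⊆ Ioi t := fun lam hl => by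
    have := hl.1
    simp only [mem_Ioi]
    linarith
  calc Real.exp (-((κ + δ) * √M))
      < (M * (M + 1))⁻¹ * Real.exp (-((κ + 2 * (δ / 3)) * (√M + 2))) := by
        rw [← div_eq_inv_mul, lt_div_iff₀ (by positivity)]
        have hMM : M * (M + 1) ≤ 2 * M ^ (2 : ℝ) := by
          rw [Real.rpow_two]
          nlinarith
        calc Real.exp (-((κ + δ) * √M)) * (M * (M + 1))
            ≤ Real.exp (-((κ + δ) * √M)) * (2 * M ^ (2 : ℝ)) := by gcongr
          _ = Real.exp (-((κ + δ) * √M)) * Real.exp (-((κ + 2 * (δ / 3)) * 2)) *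
              (2 * Real.exp ((κ + 2 * (δ / 3)) * 2) * M ^ (2 : ℝ)) := by
            rw [Real.exp_neg ((κ + 2 * (δ / 3)) * 2)]
            field_simp
          _ < Real.exp (-((κ + δ) * √M)) * Real.exp (-((κ + 2 * (δ / 3)) * 2)) *
              Real.exp (δ / 3 * √M) := by gcongr
          _ = _ := by
            rw [← Real.exp_add, ← Real.exp_add]
            congr 1
            ring
    _ = ∫ lam in Icc (M + 1) (M + 2),
          (M * (M + 1))⁻¹ * Real.exp (-((κ + 2 * (δ / 3)) * (√M + 2))) := by
        rw [setIntegral_const]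
        simp only [Real.volume_real_Icc, smul_eq_mul]
        norm_num
    _ ≤ ∫ lam in Icc (M + 1) (M + 2), (1 / t - 1 / lam) * f lam :=
        setIntegral_mono_on (integrableOn_const (by simp)) (hint.mono_set hsub)
          measurableSet_Icc hpt
    _ ≤ _ := by
        refine setIntegral_mono_set hint ((ae_restrict_iff' measurableSet_Ioi).2
          (Eventually.of_forall fun lam (hl : t < lam) => ?_)) hsub.eventuallyLE
        have : 1 / lam ≤ 1 / t := by gcongr
        exact mul_nonneg (by linarith) (hf0 lam (ht.trans hl))

/-- Low-SNR behavior of the water-filling cutoff of the double-Nakagami-m pinhole channel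
(Section III of the paper): `x(s) ~ (Ω_T Ω_R/(m_T m_R)) · (1/4) log²(1/s)` as `s → 0⁺`. -/
theorem lowSNR_cutoff_double_nakagami
    (mT mR ΩT ΩR : ℝ) (hmT : 1 / 2 ≤ mT) (hmR : 1 / 2 ≤ mR)
    (hΩT : 0 < ΩT) (hΩR : 0 < ΩR)
    (b : ℝ) (hb : b = ΩT * ΩR / (mT * mR))
    (f : ℝ → ℝ)
    (hf : ∀ lam > (0 : ℝ), f lam =
      ∫ z in Ioi (0 : ℝ),
        gammaDen mT (ΩT / mT) z * gammaDen mR (ΩR / mR) (lam / z) * z⁻¹)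
    (x : ℝ → ℝ) (hxpos : ∀ s > (0 : ℝ), 0 < x s)
    (hpow : ∀ s > (0 : ℝ),
      (∫ lam in Ioi (x s), (1 / x s - 1 / lam) * f lam) = s) :
    Tendsto (fun s => x s / (b / 4 * Real.log (1 / s) ^ 2))
      (𝓝[>] (0 : ℝ)) (𝓝 1) := by
  have hmT0 : 0 < mT := by linarith
  have hmR0 : 0 < mR := by linarith
  set a := (ΩT / mT)⁻¹ with ha
  set d := (ΩR / mR)⁻¹ with hd
  have ha0 : 0 < a := by positivity
  have hd0 : 0 < d := by positivity
  set C := (Real.Gamma mT * (ΩT / mT) ^ mT * (Real.Gamma mR * (ΩR / mR) ^ mR))⁻¹ with hC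
  have hC0 : 0 < C := by
    have := Real.Gamma_pos_of_pos hmT0
    have := Real.Gamma_pos_of_pos hmR0
    positivity
  have hfeq : ∀ lam > (0 : ℝ), f lam = C * lam ^ (mR - 1) *
      ∫ z in Ioi (0 : ℝ), z ^ (mT - mR - 1) * Real.exp (-(a * z) - d * lam / z) :=
    fun lam hlam => (hf lam hlam).trans (integral_gammaDen_mul_gammaDen_div_s16 hlam)
  have hf0 : ∀ lam > (0 : ℝ), 0 ≤ f lam := fun lam hlam => by
    rw [hfeq lam hlam]
    have : 0 ≤ ∫ z in Ioi (0 : ℝ), z ^ (mT - mR - 1) * Real.exp (-(a * z) - d * lam / z) :=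
      setIntegral_nonneg measurableSet_Ioi fun z (hz : 0 < z) => by positivity
    positivity
  set κ := 2 * √(a * d) with hκ
  have hκ0 : 0 < κ := by positivity
  have hbκ : b / 4 = (κ ^ 2)⁻¹ := by
    rw [hκ, mul_pow, Real.sq_sqrt (by positivity), ha, hd, hb]
    field_simp
    norm_num
  have hint : ∀ s > (0 : ℝ),
      IntegrableOn (fun lam => (1 / x s - 1 / lam) * f lam) (Ioi (x s)) := by
    intro s hs
    by_contra h
    have := hpow s hs
    rw [integral_undef h] at this
    exact hs.ne this
  have hlower : ∀ δ > 0, ∀ᶠ M : ℝ in atTop, ∀ s > 0, x s ≤ M →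
      Real.exp (-((κ + δ) * √M)) < s := by
    intro δ hδ
    refine (eventually_lt_cutoff_integral (p := mR - 1) hκ0 hδ hC0 hf0 ?_).mono
      fun M hM s hs hxM => ?_
    · filter_upwards [eventually_le_integral_rpow_mul_exp (mT - mR - 1) ha0 hd0
        (show 0 < δ / 3 by positivity), eventually_gt_atTop 0] with lam h hlam
      rw [hfeq lam hlam]
      gcongr
    · have := hM (x s) (hxpos s hs) hxM (hint s hs)
      rwa [hpow s hs] at this
  have hupper : ∀ δ > 0, δ < κ → ∀ᶠ t : ℝ in atTop, ∀ s > 0, x s = t →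
      s < Real.exp (-((κ - δ) * √t)) := by
    intro δ hδ hδκ
    obtain ⟨A, hA⟩ := exists_integral_rpow_mul_exp_le (mT - mR - 1) ha0 hd0
      (show 0 < δ / 2 / κ by positivity) (by rw [div_lt_one hκ0]; linarith)
    refine (eventually_cutoff_integral_lt (C := C * A) (p := mR - 1) hδ hδκ hf0 ?_).mono
      fun t ht s hs hxt => ?_
    · filter_upwards [eventually_ge_atTop 1] with lam hlam
      have hlam0 : 0 < lam := by linarith
      have h := hA lam hlam
      rw [← hκ, sub_mul, div_mul_cancel₀ _ hκ0.ne', one_mul] at h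
      rw [hfeq lam hlam0]
      calc _ ≤ C * lam ^ (mR - 1) * (A * Real.exp (-((κ - δ / 2) * √lam))) := by gcongr
        _ = _ := by ring
    · subst hxt
      have := ht (hint s hs)
      rwa [hpow s hs] at this
  have hxtop : Tendsto x (𝓝[>] 0) atTop := by
    refine tendsto_atTop.2 fun B => ?_
    obtain ⟨M, hM, hBM⟩ := ((hlower 1 one_pos).and (eventually_ge_atTop B)).exists
    filter_upwards [Ioo_mem_nhdsGT (Real.exp_pos (-((κ + 1) * √M)))] with s hs
    by_contra! h
    exact (hM s hs.1 (by linarith)).not_gt hs.2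
  have hlim : Tendsto (fun s => Real.log (1 / s) / √(x s)) (𝓝[>] 0) (𝓝 κ) := by
    refine Metric.tendsto_nhds.2 fun ε hε => ?_
    set δ := min ε (κ / 2) with hδ
    have hδ0 : 0 < δ := lt_min hε (by positivity)
    have hδε : δ ≤ ε := min_le_left _ _
    have hδκ : δ < κ := (min_le_right _ _).trans_lt (by linarith)
    filter_upwards [hxtop.eventually (hlower δ hδ0), hxtop.eventually (hupper δ hδ0 hδκ),
      self_mem_nhdsWithin] with s h1 h2 (hs : 0 < s)
    have hx0 : 0 < √(x s) := Real.sqrt_pos.2 (hxpos s hs)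
    have h3 := (Real.lt_log_iff_exp_lt hs).2 (h1 s hs le_rfl)
    have h4 := (Real.log_lt_iff_lt_exp hs).2 (h2 s hs rfl)
    rw [one_div, Real.log_inv, Real.dist_eq, abs_lt]
    constructor
    · rw [lt_sub_iff_add_lt, lt_div_iff₀ hx0]
      nlinarith
    · rw [sub_lt_iff_lt_add, div_lt_iff₀ hx0]
      nlinarith
  have hfin := ((hlim.pow 2).inv₀ (by positivity)).const_mul (κ ^ 2)
  rw [mul_inv_cancel₀ (by positivity)] at hfin
  refine hfin.congr' ?_
  filter_upwards [self_mem_nhdsWithin] with s (hs : 0 < s)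
  rw [hbκ, div_pow, Real.sq_sqrt (hxpos s hs).le, inv_div, ← div_div, div_inv_eq_mul]
  ring
end
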